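/- arXiv:1812.04030 — 11 statements merged into one kernel-verified Lean document; each statement's English description precedes it below -/
import Mathlib

section
/- Let a, b ∈ ℝ with b < a < 0, let θ̃ be the unique θ ∈ (0, π) with exp(−θ·cot θ) = cos θ, and set τ̃₁ := θ̃·cot(θ̃)/(−a). Suppose η ∈ (0, π/(2·(−b))) is such that every characteristic root for (b, η) has real part ≤ a and some characteristic root for (b, η) has real part equal to a. Set τ̃ := min{τ̃₁, η}. Then 1/(e·(−b)) < τ̃ < π/(2·(−b)); for every τ ∈ (0, τ̃), every s ∈ ℂ with s·exp(s·τ) = a or s·exp(s·τ) = b satisfies Re s < a; and for every τ ∈ (τ̃, π/(2·(−b))) there exists s ∈ ℂ with s·exp(s·τ) = a or s·exp(s·τ) = b such that Re s > a. -/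
/-- The function `θ ↦ θ cot θ`; a root `-θ cot θ + iθ` of `z exp z = -u` has its negative as
real part. -/
noncomputable def mulCot (θ : ℝ) : ℝ := θ * (Real.cos θ / Real.sin θ)

/-- The value of `u` for which `-θ cot θ + iθ` is a root of `z exp z = -u`. -/
noncomputable def branchGain (θ : ℝ) : ℝ := θ / Real.sin θ * Real.exp (-mulCot θ)

lemma mul_cos_lt_sin {θ : ℝ} (hθ : θ ∈ Set.Ioo 0 Real.pi) :
    θ * Real.cos θ < Real.sin θ := by
  have hs : 0 < Real.sin θ := Real.sin_pos_of_mem_Ioo hθ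
  rcases lt_or_ge θ (Real.pi / 2) with h | h
  · have hc : 0 < Real.cos θ := Real.cos_pos_of_mem_Ioo ⟨by linarith [hθ.1], h⟩
    have := Real.lt_tan hθ.1 h
    rwa [Real.tan_eq_sin_div_cos, lt_div_iff₀ hc] at this
  · have hc : Real.cos θ ≤ 0 := Real.cos_nonpos_of_pi_div_two_le_of_le h (by linarith [hθ.2])
    nlinarith [hθ.1]

lemma mulCot_lt_one {θ : ℝ} (hθ : θ ∈ Set.Ioo 0 Real.pi) : mulCot θ < 1 := by
  rw [mulCot, ← mul_div_assoc, div_lt_one (Real.sin_pos_of_mem_Ioo hθ)]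
  exact mul_cos_lt_sin hθ

lemma strictAntiOn_mulCot : StrictAntiOn mulCot (Set.Ioo 0 Real.pi) := by
  have hd : ∀ x ∈ Set.Ioo 0 Real.pi, HasDerivAt mulCot
      (1 * (Real.cos x / Real.sin x) +
        x * ((-Real.sin x * Real.sin x - Real.cos x * Real.cos x) / Real.sin x ^ 2)) x :=
    fun x hx => (hasDerivAt_id x).mul
      ((Real.hasDerivAt_cos x).div (Real.hasDerivAt_sin x) (Real.sin_pos_of_mem_Ioo hx).ne')
  refine strictAntiOn_of_deriv_neg (convex_Ioo _ _)
    (fun x hx => (hd x hx).continuousAt.continuousWithinAt) fun x hx => ?_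
  rw [interior_Ioo] at hx
  have hs := Real.sin_pos_of_mem_Ioo hx
  have h2 : Real.sin x * Real.cos x < x := by
    have := Real.sin_lt (show 0 < 2 * x by linarith [hx.1])
    rw [Real.sin_two_mul] at this
    linarith
  have he : 1 * (Real.cos x / Real.sin x) +
      x * ((-Real.sin x * Real.sin x - Real.cos x * Real.cos x) / Real.sin x ^ 2) =
      (Real.sin x * Real.cos x - x) / Real.sin x ^ 2 := by
    field_simp
    linear_combination (-x) * Real.sin_sq_add_cos_sq x
  rw [(hd x hx).deriv, he]
  exact div_neg_of_neg_of_pos (by linarith) (by positivity)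

lemma strictMonoOn_div_sin : StrictMonoOn (fun θ => θ / Real.sin θ) (Set.Ioo 0 Real.pi) := by
  have hd : ∀ x ∈ Set.Ioo 0 Real.pi, HasDerivAt (fun θ => θ / Real.sin θ)
      ((1 * Real.sin x - x * Real.cos x) / Real.sin x ^ 2) x :=
    fun x hx => (hasDerivAt_id x).div (Real.hasDerivAt_sin x) (Real.sin_pos_of_mem_Ioo hx).ne'
  refine strictMonoOn_of_deriv_pos (convex_Ioo _ _)
    (fun x hx => (hd x hx).continuousAt.continuousWithinAt) fun x hx => ?_
  rw [interior_Ioo] at hx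
  have hs := Real.sin_pos_of_mem_Ioo hx
  rw [(hd x hx).deriv]
  exact div_pos (by linarith [mul_cos_lt_sin hx]) (by positivity)

lemma strictMonoOn_branchGain : StrictMonoOn branchGain (Set.Ioo 0 Real.pi) := by
  intro x hx y hy hxy
  have h1 := strictMonoOn_div_sin hx hy hxy
  have h2 := strictAntiOn_mulCot hx hy hxy
  have h3 : Real.exp (-mulCot x) < Real.exp (-mulCot y) := Real.exp_lt_exp.2 (by linarith)
  have h4 : 0 < y / Real.sin y := div_pos hy.1 (Real.sin_pos_of_mem_Ioo hy)
  exact mul_lt_mul h1 h3.le (Real.exp_pos _) h4.le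

lemma branchGain_pi_div_two : branchGain (Real.pi / 2) = Real.pi / 2 := by
  simp [branchGain, mulCot]

lemma exp_neg_one_lt_branchGain {θ : ℝ} (hθ : θ ∈ Set.Ioo 0 Real.pi) :
    Real.exp (-1) < branchGain θ := by
  have h1 : 1 < θ / Real.sin θ := by
    rw [one_lt_div (Real.sin_pos_of_mem_Ioo hθ)]
    exact Real.sin_lt hθ.1
  have h2 : Real.exp (-1) < Real.exp (-mulCot θ) :=
    Real.exp_lt_exp.2 (by linarith [mulCot_lt_one hθ])
  rw [branchGain]
  nlinarith [Real.exp_pos (-1)]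

/-- Real and imaginary parts of the equation `z exp z = -u`. -/
lemma mul_exp_eq_neg_iff {z : ℂ} {u : ℝ} : z * Complex.exp z = ((-u : ℝ) : ℂ) ↔
    z.re = -(u * Real.exp (-z.re) * Real.cos z.im) ∧
      z.im = u * Real.exp (-z.re) * Real.sin z.im := by
  have h : z * Complex.exp z = ((-u : ℝ) : ℂ) ↔ z = ((-u : ℝ) : ℂ) * Complex.exp (-z) := by
    rw [Complex.exp_neg, ← div_eq_mul_inv, eq_div_iff (Complex.exp_ne_zero z)]
  rw [h, Complex.ext_iff, Complex.re_ofReal_mul, Complex.im_ofReal_mul, Complex.exp_re,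
    Complex.exp_im, Complex.neg_re, Complex.neg_im, Real.cos_neg, Real.sin_neg]
  constructor <;> rintro ⟨h1, h2⟩ <;> constructor <;> linarith

lemma branch_root {θ : ℝ} (hθ : θ ∈ Set.Ioo 0 Real.pi) :
    (⟨-mulCot θ, θ⟩ : ℂ) * Complex.exp ⟨-mulCot θ, θ⟩ = ((-branchGain θ : ℝ) : ℂ) := by
  have hs := (Real.sin_pos_of_mem_Ioo hθ).ne'
  have he : Real.exp (-mulCot θ) * Real.exp (mulCot θ) = 1 := by
    rw [← Real.exp_add, neg_add_cancel, Real.exp_zero]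
  have hg : branchGain θ * Real.exp (mulCot θ) = θ / Real.sin θ := by
    rw [branchGain, mul_assoc, he, mul_one]
  rw [mul_exp_eq_neg_iff]
  simp only [neg_neg, hg]
  constructor
  · rw [mulCot]; ring
  · field_simp

/-- Above the value `branchGain φ`, some root of `z exp z = -u` lies to the right of
`-φ cot φ`. -/
lemma exists_root_right {φ u : ℝ} (hφ : φ ∈ Set.Ioo 0 (Real.pi / 2)) (hu : branchGain φ < u)
    (hu' : u < Real.pi / 2) :
    ∃ z : ℂ, z * Complex.exp z = ((-u : ℝ) : ℂ) ∧ -mulCot φ < z.re := by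
  have hsub : ∀ x ∈ Set.Icc φ (Real.pi / 2), x ∈ Set.Ioo 0 Real.pi := fun x hx =>
    ⟨by linarith [hφ.1, hx.1], by linarith [hx.2, Real.pi_pos]⟩
  have hcont : ContinuousOn branchGain (Set.Icc φ (Real.pi / 2)) := by
    have hs : ∀ x ∈ Set.Icc φ (Real.pi / 2), Real.sin x ≠ 0 := fun x hx =>
      (Real.sin_pos_of_mem_Ioo (hsub x hx)).ne'
    unfold branchGain mulCot
    fun_prop (disch := assumption)
  obtain ⟨θ, hθ, rfl⟩ := intermediate_value_Ioo hφ.2.le hcont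
    (show u ∈ Set.Ioo _ _ from ⟨hu, by rwa [branchGain_pi_div_two]⟩)
  have hθ' := hsub θ ⟨hθ.1.le, hθ.2.le⟩
  refine ⟨_, branch_root hθ', ?_⟩
  exact neg_lt_neg (strictAntiOn_mulCot (hsub φ ⟨le_rfl, hφ.2.le⟩) hθ' hθ.1)

/-- A root of `z exp z = -u` with `-1 < Re z` and `-u ≤ Re z` is, up to conjugation, of the form
`-θ cot θ + iθ` with `θ` in `(0, π)`. -/
lemma exists_angle_of_root {z : ℂ} {u : ℝ} (hu0 : 0 < u) (hu : u < Real.pi / 2)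
    (hz : z * Complex.exp z = ((-u : ℝ) : ℂ)) (h1 : -1 < z.re) (h2 : -u ≤ z.re) :
    ∃ θ ∈ Set.Ioo 0 Real.pi, z.re = -mulCot θ ∧ u = branchGain θ := by
  obtain ⟨hx, hy⟩ := mul_exp_eq_neg_iff.1 hz
  obtain ⟨y, hy0, hx, hy⟩ : ∃ y : ℝ, 0 ≤ y ∧ z.re = -(u * Real.exp (-z.re) * Real.cos y) ∧
      y = u * Real.exp (-z.re) * Real.sin y := by
    rcases le_total 0 z.im with h | h
    · exact ⟨z.im, h, hx, hy⟩
    · exact ⟨-z.im, by linarith, by rwa [Real.cos_neg], by rw [Real.sin_neg]; linarith⟩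
  generalize z.re = x at *
  have hE := Real.exp_pos (-x)
  have hy1 : 0 < y := by
    refine hy0.lt_of_ne fun h => ?_
    rw [← h, Real.cos_zero, mul_one] at hx
    have hneg : x < 0 := by nlinarith
    have : 1 < Real.exp (-x) := Real.one_lt_exp_iff.2 (by linarith)
    nlinarith
  have hsin : 0 < Real.sin y := by
    by_contra h
    nlinarith [mul_pos hu0 hE]
  have hyle : y ≤ u * Real.exp (-x) := by
    nlinarith [Real.sin_le_one y, mul_pos hu0 hE]
  have hexp : Real.exp (-x) < 3 :=
    (Real.exp_lt_exp.2 (by linarith : -x < 1)).trans Real.exp_one_lt_three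
  have hypi : y < Real.pi := by
    by_contra h
    have : Real.sin (y - 2 * Real.pi) ≤ 0 :=
      Real.sin_nonpos_of_nonpos_of_neg_pi_le (by nlinarith) (by linarith)
    rw [Real.sin_sub_two_pi] at this
    linarith
  have hgain : u * Real.exp (-x) = y / Real.sin y := by
    rw [eq_div_iff hsin.ne']; exact hy.symm
  have hxm : x = -mulCot y := by
    rw [hgain] at hx
    rw [mulCot, hx]; ring
  refine ⟨y, ⟨hy1, hypi⟩, hxm, ?_⟩
  rw [branchGain, ← hxm, ← hgain, mul_assoc, ← Real.exp_add, neg_add_cancel, Real.exp_zero,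
    mul_one]

/-- Below the value `branchGain φ`, all roots of `z exp z = -u` lie to the left of `-v`, for
every `v ≤ u` with `v < φ cot φ`. -/
lemma root_re_lt {φ u v : ℝ} (hφ : φ ∈ Set.Ioo 0 Real.pi) (hu0 : 0 < u) (hu : u < Real.pi / 2)
    (huφ : u < branchGain φ) (hvu : v ≤ u) (hvφ : v < mulCot φ) {z : ℂ}
    (hz : z * Complex.exp z = ((-u : ℝ) : ℂ)) : z.re < -v := by
  by_contra! h
  obtain ⟨θ, hθ, hre, rfl⟩ := exists_angle_of_root hu0 hu hz
    (by linarith [mulCot_lt_one hφ]) (by linarith)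
  have := strictAntiOn_mulCot hθ hφ ((strictMonoOn_branchGain.lt_iff_lt hθ hφ).1 huφ)
  linarith

/-- Rescaling `z = sτ` turns `s exp (sτ) = α` into `z exp z = ατ`. -/
lemma mul_exp_mul_eq_iff {s : ℂ} {τ α : ℝ} (hτ : 0 < τ) :
    s * Complex.exp (s * τ) = (α : ℂ) ↔
      s * τ * Complex.exp (s * τ) = ((-(-α * τ) : ℝ) : ℂ) := by
  have h : (τ : ℂ) ≠ 0 := Complex.ofReal_ne_zero.2 hτ.ne'
  rw [← mul_left_inj' h]
  push_cast
  constructor <;> intro heq <;> linear_combination heq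

/-- Theorem 4(a) of the paper (real spectrum): with `a = α₁`, `b = α_n`,
`τ̃₁ = θ̃ cot θ̃ / |a|` and `η = η_n`, the threshold `τ̃ = min{τ̃₁, η}` lies in
`(1/(e|b|), π/(2|b|))`, below it all characteristic roots of both extreme
eigenvalue equations have real part `< a`, and above it some root has real part `> a`. -/
theorem tilde_tau_real_spectrum (a b : ℝ) (hb : b < a) (ha : a < 0)
    (θt : ℝ) (hθ1 : θt ∈ Set.Ioo 0 Real.pi)
    (hθ2 : Real.exp (-(θt * (Real.cos θt / Real.sin θt))) = Real.cos θt)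
    (hθu : ∀ θ ∈ Set.Ioo (0 : ℝ) Real.pi,
      Real.exp (-(θ * (Real.cos θ / Real.sin θ))) = Real.cos θ → θ = θt)
    (η : ℝ) (hη1 : η ∈ Set.Ioo 0 (Real.pi / (2 * (-b))))
    (hη2 : ∀ s : ℂ, s * Complex.exp (s * η) = (b : ℂ) → s.re ≤ a)
    (hη3 : ∃ s : ℂ, s * Complex.exp (s * η) = (b : ℂ) ∧ s.re = a) :
    1 / (Real.exp 1 * (-b)) < min (θt * (Real.cos θt / Real.sin θt) / (-a)) η ∧
    min (θt * (Real.cos θt / Real.sin θt) / (-a)) η < Real.pi / (2 * (-b)) ∧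
    (∀ τ : ℝ, 0 < τ → τ < min (θt * (Real.cos θt / Real.sin θt) / (-a)) η →
      ∀ s : ℂ, (s * Complex.exp (s * τ) = (a : ℂ) ∨ s * Complex.exp (s * τ) = (b : ℂ)) →
        s.re < a) ∧
    (∀ τ : ℝ, min (θt * (Real.cos θt / Real.sin θt) / (-a)) η < τ →
      τ < Real.pi / (2 * (-b)) →
      ∃ s : ℂ, (s * Complex.exp (s * τ) = (a : ℂ) ∨ s * Complex.exp (s * τ) = (b : ℂ)) ∧
        a < s.re) := by
  have hπ := Real.pi_pos
  have hB : 0 < -b := by linarith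
  have hA : 0 < -a := by linarith
  change 1 / (Real.exp 1 * (-b)) < min (mulCot θt / (-a)) η ∧ min (mulCot θt / (-a)) η < _ ∧
    (∀ τ : ℝ, 0 < τ → τ < min (mulCot θt / (-a)) η → _) ∧
    (∀ τ : ℝ, min (mulCot θt / (-a)) η < τ → _)
  have hcos : 0 < Real.cos θt := hθ2 ▸ Real.exp_pos _
  have hθt2 : θt < Real.pi / 2 := by
    by_contra! h
    linarith [Real.cos_nonpos_of_pi_div_two_le_of_le h (by linarith [hθ1.2])]
  have hgt : branchGain θt = mulCot θt := by
    change Real.exp (-mulCot θt) = _ at hθ2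
    rw [branchGain, hθ2, mulCot]; ring
  have hhalf : ∀ τ : ℝ, τ < Real.pi / (2 * (-b)) → -b * τ < Real.pi / 2 := fun τ h => by
    rw [lt_div_iff₀ (by linarith)] at h
    linarith
  obtain ⟨hη0, hηlt⟩ := hη1
  -- A root of `z exp z = ατ` gives a characteristic root after division by `τ`.
  have hunscale : ∀ α τ x : ℝ, 0 < τ →
      (∃ z : ℂ, z * Complex.exp z = ((-(-α * τ) : ℝ) : ℂ) ∧ x * τ < z.re) →
      ∃ s : ℂ, s * Complex.exp (s * τ) = (α : ℂ) ∧ x < s.re := by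
    rintro α τ x hτ ⟨z, hz, hre⟩
    have h : (τ : ℂ) ≠ 0 := Complex.ofReal_ne_zero.2 hτ.ne'
    refine ⟨z / τ, (mul_exp_mul_eq_iff hτ).2 (by rwa [div_mul_cancel₀ _ h]), ?_⟩
    rwa [Complex.div_ofReal_re, lt_div_iff₀ hτ]
  have haη : -a * η < 1 := by
    by_contra! h
    have hone := mulCot_lt_one hθ1
    obtain ⟨s, hs, hre⟩ := hunscale b η a hη0 <| by
      obtain ⟨z, hz, hre⟩ := exists_root_right (u := -b * η) ⟨hθ1.1, hθt2⟩
        (by nlinarith) (hhalf η hηlt)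
      exact ⟨z, hz, by linarith⟩
    exact (hη2 s hs).not_gt hre
  obtain ⟨φ, hφ, hφre, hφu⟩ : ∃ φ ∈ Set.Ioo 0 Real.pi, -a * η = mulCot φ ∧
      -b * η = branchGain φ := by
    obtain ⟨s, hs, hre⟩ := hη3
    have hre' : (s * (η : ℂ)).re = a * η := by rw [Complex.re_mul_ofReal, hre]
    obtain ⟨φ, hφ, h1, h2⟩ := exists_angle_of_root (mul_pos hB hη0) (hhalf η hηlt)
      ((mul_exp_mul_eq_iff hη0).1 hs) (by linarith) (by nlinarith)
    exact ⟨φ, hφ, by linarith, h2⟩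
  have hφ2 : φ < Real.pi / 2 := by
    by_contra! h
    have hc := Real.cos_nonpos_of_pi_div_two_le_of_le h (by linarith [hφ.2])
    have : mulCot φ ≤ 0 := mul_nonpos_of_nonneg_of_nonpos hφ.1.le
      (div_nonpos_of_nonpos_of_nonneg hc (Real.sin_pos_of_mem_Ioo hφ).le)
    nlinarith
  have hlow : ∀ τ : ℝ, Real.exp (-1) < -b * τ → 1 / (Real.exp 1 * (-b)) < τ := fun τ h => by
    rw [Real.exp_neg] at h
    rw [one_div, mul_inv, ← div_eq_mul_inv, div_lt_iff₀ hB]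
    linarith
  refine ⟨lt_min (hlow _ ?_) (hlow _ ?_), min_lt_of_right_lt hηlt, ?_, ?_⟩
  · have h := exp_neg_one_lt_branchGain hθ1
    have h0 : 0 < mulCot θt := by rw [← hgt]; exact (Real.exp_pos _).trans h
    have h1 : 0 < mulCot θt / -a := div_pos h0 hA
    have h2 : -a * (mulCot θt / -a) = mulCot θt := mul_div_cancel₀ _ hA.ne'
    nlinarith
  · rw [hφu]
    exact exp_neg_one_lt_branchGain hφ
  · intro τ hτ hlt s hs
    obtain ⟨h1, h2⟩ := lt_min_iff.1 hlt
    rw [lt_div_iff₀ hA] at h1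
    have hbτ := hhalf τ (h2.trans hηlt)
    have key : (s * (τ : ℂ)).re < -(-a * τ) := by
      rcases hs with hs | hs
      · exact root_re_lt hθ1 (mul_pos hA hτ) (by nlinarith) (by linarith) le_rfl (by linarith)
          ((mul_exp_mul_eq_iff hτ).1 hs)
      · exact root_re_lt hφ (mul_pos hB hτ) hbτ (by nlinarith) (by nlinarith) (by nlinarith)
          ((mul_exp_mul_eq_iff hτ).1 hs)
    rw [Complex.re_mul_ofReal] at key
    nlinarith
  · intro τ hlt hτ2
    have hbτ := hhalf τ hτ2
    rcases min_lt_iff.1 hlt with h | h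
    · have hτ : 0 < τ := by
        have h0 := (Real.exp_pos _).trans (exp_neg_one_lt_branchGain hθ1)
        rw [hgt] at h0
        exact (div_pos h0 hA).trans h
      rw [div_lt_iff₀ hA] at h
      obtain ⟨z, hz, hre⟩ := exists_root_right (u := -a * τ) ⟨hθ1.1, hθt2⟩ (by linarith)
        (by nlinarith)
      obtain ⟨s, hs, hre⟩ := hunscale a τ a hτ ⟨z, hz, by linarith⟩
      exact ⟨s, Or.inl hs, hre⟩
    · obtain ⟨z, hz, hre⟩ := exists_root_right (u := -b * τ) ⟨hφ.1, hφ2⟩ (by nlinarith) hbτ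
      obtain ⟨s, hs, hre⟩ := hunscale b τ a (hη0.trans h) ⟨z, hz, by nlinarith⟩
      exact ⟨s, Or.inr hs, hre⟩
end

section
/- Let a, b ∈ ℝ with b < a < 0. Define u := arccos(a/b), c := u / √((b/a)² − 1), τ* := (c/(−a))·exp(−c), and ρ* := (−a)·exp(c). Then: (i) the complex identity (−c + u·i)·exp(−c + u·i) = b·τ* holds; (ii) (−ρ*)·exp(−ρ*·τ*) = a, so s = −ρ* is a characteristic root for (a, τ*); and (iii) every s ∈ ℂ with s·exp(s·τ*) = a or s·exp(s·τ*) = b satisfies Re s ≤ −ρ*. -/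
/-- `sin x / x` is antitone on `(0, π]`, stated without division. -/
theorem mul_sin_le_mul_sin_of_le {v w : ℝ} (hv : 0 ≤ v) (hvw : v ≤ w) (hw : w ≤ Real.pi) :
    v * Real.sin w ≤ w * Real.sin v := by
  rcases hv.eq_or_lt with rfl | hv0
  · simp
  have hw0 : 0 < w := hv0.trans_le hvw
  have h := strictConcaveOn_sin_Icc.concaveOn.2
    ⟨le_rfl, Real.pi_pos.le⟩ ⟨hw0.le, hw⟩
    (sub_nonneg.2 ((div_le_one hw0).2 hvw)) (div_nonneg hv hw0.le) (sub_add_cancel 1 (v / w))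
  simp only [smul_eq_mul, mul_zero, zero_add, Real.sin_zero, div_mul_cancel₀ v hw0.ne'] at h
  calc v * Real.sin w = w * (v / w * Real.sin w) := by field_simp
    _ ≤ w * Real.sin v := by gcongr

/-- `x * cot x` is antitone on `(0, π)`, stated without division. -/
theorem mul_cos_mul_sin_le {y u : ℝ} (hy : 0 ≤ y) (hyu : y ≤ u) (hu : u ≤ Real.pi) :
    u * Real.cos u * Real.sin y ≤ y * Real.cos y * Real.sin u := by
  have h₁ := mul_sin_le_mul_sin_of_le (sub_nonneg.2 hyu) (sub_le_self u hy) hu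
  have h₂ : (u - y) * Real.sin u * Real.cos y ≤ (u - y) * Real.sin u :=
    mul_le_of_le_one_right (mul_nonneg (sub_nonneg.2 hyu)
      (Real.sin_nonneg_of_nonneg_of_le_pi (hy.trans hyu) hu)) (Real.cos_le_one y)
  rw [Real.sin_sub] at h₁
  linarith

/-- `x * exp x` is injective to the right of `-1`, in the form of a one-sided bound. -/
theorem le_neg_of_mul_exp_le {x c : ℝ} (hc : 0 < c) (hc1 : c < 1)
    (h : x * Real.exp x ≤ -(c * Real.exp (-c))) : x ≤ -c := by
  by_contra! hx
  have he : Real.exp (-c) = Real.exp x * Real.exp (-(c + x)) := by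
    rw [← Real.exp_add]; ring_nf
  have h₁ : c * Real.exp (-(c + x)) ≤ -x := by
    refine le_of_mul_le_mul_left ?_ (Real.exp_pos x)
    rw [he] at h
    linarith
  nlinarith [Real.add_one_le_exp (-(c + x)), mul_pos (sub_pos.2 hx) (sub_pos.2 hc1)]

/-- A complex number `x + y * I` in the closed upper half plane whose image under `z ↦ z * exp z`
is the real number `-r` has `x ≤ -c` as soon as `-r` lies between the values of `z ↦ z * exp z` at
`-c + u * I` and at `-c`, where `c = u * cot u`. -/
theorem le_neg_of_mul_exp_eq {u c r x y : ℝ} (hu : 0 < u) (hu2 : u < Real.pi / 2)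
    (hc : 0 < c) (hc1 : c < 1) (hcu : c * Real.sin u = u * Real.cos u)
    (hr : c * Real.exp (-c) ≤ r) (hr' : r * Real.sin u ≤ u * Real.exp (-c)) (hy : 0 ≤ y)
    (hre : (x * Real.cos y - y * Real.sin y) * Real.exp x = -r)
    (him : x * Real.sin y + y * Real.cos y = 0) : x ≤ -c := by
  have hsu : 0 < Real.sin u := Real.sin_pos_of_pos_of_lt_pi hu (by linarith)
  rcases hy.eq_or_lt with rfl | hy0
  · refine le_neg_of_mul_exp_le hc hc1 ?_
    simp only [Real.cos_zero, mul_one, zero_mul, sub_zero] at hre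
    linarith
  rcases le_or_gt y u with hyu | huy
  · have hsy : 0 < Real.sin y := Real.sin_pos_of_pos_of_lt_pi hy0 (by linarith)
    have h := mul_cos_mul_sin_le hy hyu (by linarith)
    rw [← hcu] at h
    have h' : c * (Real.sin u * Real.sin y) ≤ -x * (Real.sin u * Real.sin y) := by
      linear_combination h + Real.sin u * him
    linarith [le_of_mul_le_mul_right h' (mul_pos hsu hsy)]
  have hmod : y * Real.exp x = r * Real.sin y := by
    linear_combination (-Real.sin y) * hre + Real.cos y * Real.exp x * him -
      y * Real.exp x * Real.sin_sq_add_cos_sq y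
  rw [← Real.exp_le_exp]
  refine le_of_mul_le_mul_left ?_ (mul_pos hy0 hsu)
  have hexp := Real.exp_pos (-c)
  have hsin : u * Real.sin y ≤ y * Real.sin u := by
    rcases le_or_gt y Real.pi with hyπ | hπy
    · exact mul_sin_le_mul_sin_of_le hu.le huy.le hyπ
    · have hj : 2 * u ≤ Real.pi * Real.sin u := by
        have := Real.mul_le_sin hu.le hu2.le
        calc 2 * u = Real.pi * (2 / Real.pi * u) := by field_simp
          _ ≤ _ := by gcongr
      nlinarith [Real.sin_le_one y]
  have hsy : 0 ≤ Real.sin y := by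
    have hr0 : 0 < r := lt_of_lt_of_le (by positivity) hr
    refine (pos_of_mul_pos_right (a := r) ?_ hr0.le).le
    rw [← hmod]
    positivity
  calc y * Real.sin u * Real.exp x = r * Real.sin u * Real.sin y := by
        linear_combination Real.sin u * hmod
    _ ≤ u * Real.exp (-c) * Real.sin y := by gcongr
    _ = u * Real.sin y * Real.exp (-c) := by ring
    _ ≤ y * Real.sin u * Real.exp (-c) := by gcongr

/-- Version of `le_neg_of_mul_exp_eq` for complex numbers in either half plane. -/
theorem re_le_neg_of_mul_exp_eq {u c r : ℝ} (hu : 0 < u) (hu2 : u < Real.pi / 2)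
    (hc : 0 < c) (hc1 : c < 1) (hcu : c * Real.sin u = u * Real.cos u)
    (hr : c * Real.exp (-c) ≤ r) (hr' : r * Real.sin u ≤ u * Real.exp (-c)) {z : ℂ}
    (hz : z * Complex.exp z = ((-r : ℝ) : ℂ)) : z.re ≤ -c := by
  have hre := congrArg Complex.re hz
  have him := congrArg Complex.im hz
  simp only [Complex.mul_re, Complex.mul_im, Complex.exp_re, Complex.exp_im, Complex.ofReal_re,
    Complex.ofReal_im] at hre him
  have him' : z.re * Real.sin z.im + z.im * Real.cos z.im = 0 := by
    refine (mul_eq_zero.1 ?_).resolve_left (Real.exp_pos z.re).ne'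
    linear_combination him
  rcases le_total 0 z.im with hy | hy
  · exact le_neg_of_mul_exp_eq hu hu2 hc hc1 hcu hr hr' hy (by linear_combination hre) him'
  · refine le_neg_of_mul_exp_eq hu hu2 hc hc1 hcu hr hr' (neg_nonneg.2 hy) ?_ ?_
    · rw [Real.sin_neg, Real.cos_neg]
      linear_combination hre
    · rw [Real.sin_neg, Real.cos_neg]
      linear_combination -him'

/-- Theorem 4(b) of the paper: exact value of the maximum rate of convergence
`ρ* = |a|·exp(c)` and the maximizing delay `τ* = (c/|a|)·exp(−c)`, where
`c = arccos(a/b)/√((b/a)² − 1)`. At `τ*` the rightmost characteristic roots of the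
two extreme eigenvalue equations have common real part `−ρ*`. -/
theorem max_rate_real_spectrum (a b : ℝ) (hb : b < a) (ha : a < 0) :
    let u := Real.arccos (a / b)
    let c := u / Real.sqrt ((b / a) ^ 2 - 1)
    let τs := c / (-a) * Real.exp (-c)
    let ρs := (-a) * Real.exp c
    (((-c : ℂ) + (u : ℂ) * Complex.I) * Complex.exp ((-c : ℂ) + (u : ℂ) * Complex.I)
        = ((b * τs : ℝ) : ℂ)) ∧
    ((-ρs) * Real.exp (-ρs * τs) = a) ∧
    (∀ s : ℂ, (s * Complex.exp (s * τs) = (a : ℂ) ∨ s * Complex.exp (s * τs) = (b : ℂ)) →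
      s.re ≤ -ρs) := by
  intro u c τs ρs
  have hb0 : b < 0 := hb.trans ha
  have ha' : a ≠ 0 := ha.ne
  have hb' : b ≠ 0 := hb0.ne
  have hq0 : 0 < a / b := div_pos_of_neg_of_neg ha hb0
  have hq1 : a / b < 1 := (div_lt_one_of_neg hb0).2 hb
  have hu : 0 < u := Real.arccos_pos.2 hq1
  have hu2 : u < Real.pi / 2 := Real.arccos_lt_pi_div_two.2 hq0
  have hcos : Real.cos u = a / b := Real.cos_arccos (by linarith) hq1.le
  have hsin : 0 < Real.sin u := Real.sin_pos_of_pos_of_lt_pi hu (by linarith)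
  have hcos0 : 0 < Real.cos u := hcos ▸ hq0
  have hbcos : b * Real.cos u = a := by rw [hcos]; field_simp
  have hsqrt : Real.sqrt ((b / a) ^ 2 - 1) = Real.tan u := by
    have h : (b / a) ^ 2 - 1 = Real.tan u ^ 2 := by
      rw [Real.tan_eq_sin_div_cos, div_pow (Real.sin u), Real.sin_sq, hcos]
      field_simp
    rw [h, Real.sqrt_sq (Real.tan_pos_of_pos_of_lt_pi_div_two hu hu2).le]
  have hc_def : c = u / Real.tan u := by rw [← hsqrt]
  have htan : u < Real.tan u := Real.lt_tan hu hu2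
  have hc : 0 < c := hc_def ▸ div_pos hu (hu.trans htan)
  have hc1 : c < 1 := by rw [hc_def]; exact (div_lt_one (hu.trans htan)).2 htan
  have hcu : c * Real.sin u = u * Real.cos u := by
    rw [hc_def, Real.tan_eq_sin_div_cos]
    field_simp
  have haτ : a * τs = -(c * Real.exp (-c)) := by
    simp only [τs]
    field_simp
  have hbτ : b * τs * Real.sin u = -(u * Real.exp (-c)) := by
    refine mul_right_cancel₀ hcos0.ne' ?_
    linear_combination τs * Real.sin u * hbcos + Real.sin u * haτ - Real.exp (-c) * hcu
  have hτ : 0 < τs := mul_pos (div_pos hc (neg_pos.2 ha)) (Real.exp_pos _)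
  have hρτ : ρs * τs = c := by
    have hexp : Real.exp c * Real.exp (-c) = 1 := by rw [← Real.exp_add]; simp
    calc ρs * τs = -(a * τs) * Real.exp c := by simp only [ρs]; ring
      _ = c * (Real.exp c * Real.exp (-c)) := by rw [haτ]; ring
      _ = c := by rw [hexp, mul_one]
  refine ⟨?_, ?_, ?_⟩
  · have hre : (-c * Real.cos u - u * Real.sin u) * Real.exp (-c) = b * τs := by
      refine mul_right_cancel₀ hsin.ne' ?_
      linear_combination (-Real.cos u * Real.exp (-c)) * hcu - hbτ -
        u * Real.exp (-c) * Real.sin_sq_add_cos_sq u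
    apply Complex.ext
    · simp [Complex.exp_re, Complex.exp_im, -Complex.ofReal_mul]
      linear_combination hre
    · simp [Complex.exp_re, Complex.exp_im, -Complex.ofReal_mul]
      linear_combination -Real.exp (-c) * hcu
  · rw [neg_mul, neg_mul, hρτ]
    simp only [ρs]
    rw [mul_assoc, ← Real.exp_add]
    simp
  · intro s hs
    have hz : (s * τs).re ≤ -c := by
      rcases hs with hs | hs
      · refine re_le_neg_of_mul_exp_eq (r := -(a * τs)) hu hu2 hc hc1 hcu ?_ ?_ ?_
        · rw [haτ, neg_neg]
        · rw [haτ, neg_neg]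
          have := mul_le_of_le_one_right hu.le (Real.cos_le_one u)
          calc c * Real.exp (-c) * Real.sin u = u * Real.cos u * Real.exp (-c) := by
                rw [← hcu]; ring
            _ ≤ u * Real.exp (-c) := by gcongr
        · push_cast
          linear_combination (τs : ℂ) * hs
      · refine re_le_neg_of_mul_exp_eq (r := -(b * τs)) hu hu2 hc hc1 hcu ?_ ?_ ?_
        · nlinarith
        · linarith
        · push_cast
          linear_combination (τs : ℂ) * hs
    rw [Complex.re_mul_ofReal, ← hρτ, ← neg_mul] at hz
    exact le_of_mul_le_mul_right hz hτ
end

section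
/- Let a, b ∈ ℝ with b < a < 0. Define u := arccos(a/b), c := u / √((b/a)² − 1), and ρ* := (−a)·exp(c). Then for every τ > 0 there exists s ∈ ℂ with s·exp(s·τ) = a or s·exp(s·τ) = b such that Re s ≥ −ρ*. -/
open Real in
/-- The map `x ↦ x * cot x` is antitone on `(0, π / 2]`. -/
lemma mul_cos_div_sin_le {u x : ℝ} (hu : 0 < u) (hux : u ≤ x) (hx : x ≤ π / 2) :
    x * cos x / sin x ≤ u * cos u / sin u := by
  have hpi := pi_pos
  have hsu : 0 < sin u := sin_pos_of_pos_of_lt_pi hu (by linarith)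
  have hsx : 0 < sin x := sin_pos_of_pos_of_lt_pi (by linarith) (by linarith)
  have hcx : 0 ≤ cos x := cos_nonneg_of_mem_Icc ⟨by linarith, hx⟩
  have hd0 : 0 ≤ x - u := by linarith
  have hcd : 0 < cos (x - u) := cos_pos_of_mem_Ioo ⟨by linarith, by linarith⟩
  have htan : (x - u) * cos (x - u) ≤ sin (x - u) := by
    have h := le_tan hd0 (by linarith)
    rwa [tan_eq_sin_div_cos, le_div_iff₀ hcd] at h
  have hcos : cos x ≤ cos (x - u) :=
    cos_le_cos_of_nonneg_of_le_pi hd0 (by linarith) (by linarith)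
  have hsin : (x - u) * cos x ≤ sin (x - u) :=
    (mul_le_mul_of_nonneg_left hcos hd0).trans htan
  have hkey : (x - u) * cos x * sin u ≤ sin (x - u) * u :=
    mul_le_mul hsin (sin_le hu.le) hsu.le ((mul_nonneg hd0 hcx).trans hsin)
  rw [sin_sub] at hkey
  rw [div_le_div_iff₀ hsx hsu]
  linarith

open Real in
/-- A real solution `x` of `x * exp (-x) = A * τ` yields the characteristic root `-x / τ`. -/
lemma exists_real_root {A τ c : ℝ} (hA : 0 < A) (hτ : 0 < τ) (hc : 0 ≤ c)
    (h : A * τ ≤ c * exp (-c)) :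
    ∃ s : ℂ, s * Complex.exp (s * τ) = ((-A : ℝ) : ℂ) ∧ -(A * exp c) ≤ s.re := by
  have hcont : ContinuousOn (fun x : ℝ => x * exp (-x)) (Set.Icc 0 c) := by fun_prop
  obtain ⟨x, ⟨-, hxc⟩, hx⟩ :=
    intermediate_value_Icc hc hcont (show A * τ ∈ _ from ⟨by simp; positivity, h⟩)
  have hxτ : x = A * τ * exp x := by
    rw [← hx, mul_assoc, ← exp_add]; simp
  refine ⟨((-(A * exp x) : ℝ) : ℂ), ?_, ?_⟩
  · have hmul : -(A * exp x) * τ = -x := by linear_combination hxτ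
    rw [← Complex.ofReal_mul, hmul, ← Complex.ofReal_exp, ← Complex.ofReal_mul, neg_mul,
      mul_assoc, ← exp_add]
    simp
  · rw [Complex.ofReal_re]
    exact neg_le_neg (mul_le_mul_of_nonneg_left (exp_le_exp.2 hxc) hA.le)

open Real in
/-- A solution `x ∈ (0, π)` of `B * τ * sin x * exp (x * cot x) = x` yields a characteristic root
with imaginary part `x / τ`. -/
lemma complex_root_of_eq {B τ x : ℝ} (hx : 0 < x) (hxpi : x < π)
    (h : B * τ * sin x * exp (x * cos x / sin x) = x) :
    ∃ s : ℂ, s * Complex.exp (s * τ) = ((-B : ℝ) : ℂ) ∧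
      s.re = -(B * cos x * exp (x * cos x / sin x)) := by
  have hs : 0 < sin x := sin_pos_of_pos_of_lt_pi hx hxpi
  set p := x * cos x / sin x with hp
  have hpx : p * sin x = x * cos x := by rw [hp]; field_simp
  have hre : B * cos x * exp p * τ = p := by
    apply mul_right_cancel₀ hs.ne'
    rw [hpx]
    linear_combination cos x * h
  have him : B * sin x * exp p * τ = x := by linear_combination h
  refine ⟨⟨-(B * cos x * exp p), B * sin x * exp p⟩, ?_, rfl⟩
  have hmul : (⟨-(B * cos x * exp p), B * sin x * exp p⟩ : ℂ) * τ = ⟨-p, x⟩ := by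
    apply Complex.ext
    · simp only [Complex.mul_re, Complex.ofReal_re, Complex.ofReal_im]
      linear_combination -hre
    · simp only [Complex.mul_im, Complex.ofReal_re, Complex.ofReal_im]
      linear_combination him
  have hexp : exp p * exp (-p) = 1 := by rw [← exp_add]; simp
  have hsq := sin_sq_add_cos_sq x
  rw [hmul]
  apply Complex.ext
  · simp only [Complex.mul_re, Complex.exp_re, Complex.exp_im, Complex.ofReal_re]
    linear_combination -B * (sin x ^ 2 + cos x ^ 2) * hexp - B * hsq
  · simp only [Complex.mul_im, Complex.exp_re, Complex.exp_im, Complex.ofReal_im]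
    ring

open Real in
/-- Existence of a solution of `K * sin x * exp (x * cot x) = x` in `[u, π)`. -/
lemma exists_mul_sin_mul_exp_eq {K u : ℝ} (hK : 0 < K) (hu : 0 < u) (hu2 : u ≤ π / 2)
    (h : u ≤ K * sin u * exp (u * cos u / sin u)) :
    ∃ x, u ≤ x ∧ x < π ∧ K * sin x * exp (x * cos x / sin x) = x := by
  have hpi := pi_pos
  set k := min 1 (π / 2 / K)
  have hk0 : 0 < k := lt_min one_pos (by positivity)
  have hk1 : k ≤ 1 := min_le_left _ _
  have hKk : K * k ≤ π / 2 := by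
    have : k ≤ π / 2 / K := min_le_right _ _
    rwa [le_div_iff₀ hK, mul_comm] at this
  set v := π - arcsin k with hv
  have hsv : sin v = k := by rw [hv, sin_pi_sub, sin_arcsin (by linarith) hk1]
  have hvpi : v < π := by have := arcsin_pos.2 hk0; linarith
  have hv2 : π / 2 ≤ v := by have := arcsin_le_pi_div_two k; linarith
  have hexp : exp (v * cos v / sin v) ≤ 1 := by
    rw [exp_le_one_iff, hsv]
    exact div_nonpos_of_nonpos_of_nonneg (mul_nonpos_of_nonneg_of_nonpos (by linarith)
      (cos_nonpos_of_pi_div_two_le_of_le hv2 (by linarith))) hk0.le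
  have hgv : K * sin v * exp (v * cos v / sin v) - v ≤ 0 := by
    rw [hsv] at hexp ⊢
    have := mul_le_mul_of_nonneg_left hexp (mul_pos hK hk0).le
    linarith
  have hcont : ContinuousOn (fun x : ℝ => K * sin x * exp (x * cos x / sin x) - x)
      (Set.Icc u v) := by
    have hne : ∀ x ∈ Set.Icc u v, sin x ≠ 0 := fun x hx =>
      (sin_pos_of_pos_of_lt_pi (hu.trans_le hx.1) (hx.2.trans_lt hvpi)).ne'
    fun_prop (disch := assumption)
  obtain ⟨x, hx, hx0⟩ := intermediate_value_Icc' (hu2.trans hv2) hcont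
    (show (0 : ℝ) ∈ _ from ⟨hgv, sub_nonneg.2 h⟩)
  exact ⟨x, hx.1, hx.2.trans_lt hvpi, sub_eq_zero.1 hx0⟩

/-- Theorem 4(b) of the paper, maximality of `ρ*`: for every positive delay the
rightmost characteristic root over the two extreme eigenvalue equations has real
part at least `−ρ* = −|a|·exp(arccos(a/b)/√((b/a)² − 1))`. -/
theorem rate_bounded_by_rho_star (a b : ℝ) (hb : b < a) (ha : a < 0) :
    ∀ τ : ℝ, 0 < τ →
      ∃ s : ℂ, (s * Complex.exp (s * τ) = (a : ℂ) ∨ s * Complex.exp (s * τ) = (b : ℂ)) ∧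
        -((-a) * Real.exp (Real.arccos (a / b) / Real.sqrt ((b / a) ^ 2 - 1))) ≤ s.re := by
  intro τ hτ
  have hb0 : b < 0 := hb.trans ha
  have hr0 : 0 < a / b := div_pos_of_neg_of_neg ha hb0
  have hr1 : a / b < 1 := by rw [div_lt_one_of_neg hb0]; exact hb
  set u := Real.arccos (a / b)
  have hu0 : 0 < u := Real.arccos_pos.2 hr1
  have hu2 : u < Real.pi / 2 := Real.arccos_lt_pi_div_two.2 hr0
  have hcos : Real.cos u = a / b := Real.cos_arccos (by linarith) hr1.le
  have hsin : 0 < Real.sin u := Real.sin_pos_of_pos_of_lt_pi hu0 (by linarith)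
  have hcu : 0 < Real.cos u := hcos ▸ hr0
  have hsqrt : Real.sqrt ((b / a) ^ 2 - 1) = Real.sin u / Real.cos u := by
    have hba : b / a = 1 / Real.cos u := by rw [hcos, one_div_div]
    rw [hba, ← Real.sqrt_sq (div_pos hsin hcu).le]
    congr 1
    field_simp
    linarith [Real.sin_sq_add_cos_sq u]
  have hA : a = b * Real.cos u := by rw [hcos]; field_simp [hb0.ne]
  rw [hsqrt, div_div_eq_mul_div]
  set c := u * Real.cos u / Real.sin u with hc
  have hcs : c * Real.sin u = u * Real.cos u := by rw [hc]; field_simp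
  have hc0 : 0 < c := by positivity
  rcases le_total (-a * τ) (c * Real.exp (-c)) with h | h
  · obtain ⟨s, hs, hre⟩ := exists_real_root (neg_pos.2 ha) hτ hc0.le h
    exact ⟨s, Or.inl (by simpa using hs), hre⟩
  · have hstart : u ≤ -b * τ * Real.sin u * Real.exp c := by
      have hcexp : c ≤ -a * τ * Real.exp c := by
        have := mul_le_mul_of_nonneg_right h (Real.exp_pos c).le
        rwa [mul_assoc, ← Real.exp_add, neg_add_cancel, Real.exp_zero, mul_one] at this
      have := mul_le_mul_of_nonneg_right hcexp hsin.le
      rw [hcs, hA] at this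
      refine le_of_mul_le_mul_right (this.trans_eq ?_) hcu
      ring
    obtain ⟨x, hux, hxpi, hx⟩ :=
      exists_mul_sin_mul_exp_eq (mul_pos (neg_pos.2 hb0) hτ) hu0 hu2.le hstart
    obtain ⟨s, hs, hre⟩ := complex_root_of_eq (hu0.trans_le hux) hxpi hx
    refine ⟨s, Or.inr (by simpa using hs), ?_⟩
    rw [hre, neg_le_neg_iff]
    rcases le_total x (Real.pi / 2) with hx2 | hx2
    · have hle : Real.cos x ≤ Real.cos u :=
        Real.cos_le_cos_of_nonneg_of_le_pi hu0.le hxpi.le hux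
      have ha' : -a = -b * Real.cos u := by rw [neg_mul, ← hA]
      rw [ha']
      exact mul_le_mul (mul_le_mul_of_nonneg_left hle (by linarith))
        (Real.exp_le_exp.2 (mul_cos_div_sin_le hu0 hux hx2)) (Real.exp_pos _).le
        (mul_nonneg (by linarith) hcu.le)
    · have hle : Real.cos x ≤ 0 :=
        Real.cos_nonpos_of_pi_div_two_le_of_le hx2 (by linarith)
      exact (mul_nonpos_of_nonpos_of_nonneg
        (mul_nonpos_of_nonneg_of_nonpos (by linarith) hle) (Real.exp_pos _).le).trans
        (mul_pos (neg_pos.2 ha) (Real.exp_pos _)).le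
end

section
/- Let n ≥ 1 and let a : Fin n → ℝ with a i < 0 for all i; set a₊ := max_i a i and a₋ := min_i a i. Then for every τ with 0 < τ < 1/(e·(−a₋)) there exists s₀ ∈ ℝ with s₀·exp(s₀·τ) = a₊ such that for every i and every s ∈ ℂ with s·exp(s·τ) = a i, one has Re s ≤ s₀. -/
/-- The real characteristic function `t ↦ t * exp (t * τ)` is strictly increasing to the right of
its minimiser `-1 / τ`, here compared at a negative left endpoint. -/
lemma mul_exp_mul_lt_mul_exp_mul {τ w x : ℝ} (hτ : 0 < τ) (hw : -1 ≤ w * τ) (hw0 : w < 0)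
    (hwx : w < x) : w * Real.exp (w * τ) < x * Real.exp (x * τ) := by
  have hne : (w - x) * τ ≠ 0 := (mul_neg_of_neg_of_pos (sub_neg.2 hwx) hτ).ne
  have hexp := Real.add_one_lt_exp hne
  have hfactor : w * Real.exp ((w - x) * τ) < x := by
    nlinarith [mul_nonneg (sub_nonneg.2 hwx.le) (by linarith : 0 ≤ w * τ + 1)]
  calc w * Real.exp (w * τ) = w * Real.exp ((w - x) * τ) * Real.exp (x * τ) := by
        rw [mul_assoc, ← Real.exp_add]; ring_nf
    _ < x * Real.exp (x * τ) := mul_lt_mul_of_pos_right hfactor (Real.exp_pos _)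

/-- For a real coefficient, the imaginary part of a characteristic root. -/
lemma im_mul_exp_eq_of_mul_exp_eq {τ α : ℝ} {s : ℂ} (hs : s * Complex.exp (s * τ) = (α : ℂ)) :
    s.im * Real.exp (s.re * τ) = -α * Real.sin (s.im * τ) := by
  have hre := congrArg Complex.re hs
  have him := congrArg Complex.im hs
  simp only [Complex.mul_re, Complex.mul_im, Complex.exp_re, Complex.exp_im, Complex.ofReal_re,
    Complex.ofReal_im, mul_zero, sub_zero, zero_add] at hre him
  linear_combination Real.cos (s.im * τ) * him - Real.sin (s.im * τ) * hre
    - s.im * Real.exp (s.re * τ) * Real.sin_sq_add_cos_sq (s.im * τ)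

/-- If `|α| * τ < exp (-1)`, every characteristic root to the right of `-1 / τ` is real. -/
lemma im_eq_zero_of_mul_exp_eq {τ α : ℝ} (hτ : 0 < τ) (hα : |α| * τ < Real.exp (-1)) {s : ℂ}
    (hs : s * Complex.exp (s * τ) = (α : ℂ)) (hre : -1 ≤ s.re * τ) : s.im = 0 := by
  by_contra hne
  have hpos : 0 < |s.im| := abs_pos.2 hne
  have habs := congrArg abs (im_mul_exp_eq_of_mul_exp_eq hs)
  rw [abs_mul, abs_mul, abs_neg, Real.abs_exp] at habs
  have hsin : |Real.sin (s.im * τ)| ≤ |s.im| * τ := by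
    simpa [abs_mul, abs_of_pos hτ] using Real.abs_sin_le_abs (x := s.im * τ)
  have hle := mul_le_mul_of_nonneg_left hsin (abs_nonneg α)
  have hexp := Real.exp_le_exp.2 hre
  nlinarith

/-- For `α` negative with `-exp (-1) < α * τ`, the characteristic equation has a negative real root
to the right of `-1 / τ`. -/
lemma exists_neg_root_mul_exp_eq {τ α : ℝ} (hτ : 0 < τ) (hα : α < 0)
    (hατ : -Real.exp (-1) < α * τ) :
    ∃ w : ℝ, w < 0 ∧ -1 ≤ w * τ ∧ w * Real.exp (w * τ) = α := by
  have hcont : ContinuousOn (fun t : ℝ => t * Real.exp (t * τ)) (Set.Icc (-1 / τ) 0) := by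
    fun_prop
  have hleft : -1 / τ * Real.exp (-1 / τ * τ) ≤ α := by
    rw [div_mul_cancel₀ _ hτ.ne', div_mul_eq_mul_div, div_le_iff₀ hτ]
    linarith
  obtain ⟨w, hw, hwα⟩ := intermediate_value_Icc
    (div_nonpos_of_nonpos_of_nonneg (by norm_num) hτ.le) hcont ⟨hleft, by simpa using hα.le⟩
  refine ⟨w, lt_of_le_of_ne hw.2 ?_, (div_le_iff₀ hτ).1 hw.1, hwα⟩
  rintro rfl
  simp only [zero_mul] at hwα
  exact hα.ne hwα.symm

/-- Lemma 8(a) of the paper: for a real negative spectrum and delays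
`τ ∈ (0, 1/(e·|a₋|))`, the rightmost characteristic root over all eigenvalue
equations is the real root of the `a₊`-equation. -/
theorem rightmost_root_small_delay (n : ℕ) (hn : 1 ≤ n) (a : Fin n → ℝ)
    (ha : ∀ i, a i < 0)
    (ap : ℝ) (hap : IsGreatest (Set.range a) ap)
    (am : ℝ) (ham : IsLeast (Set.range a) am) :
    ∀ τ : ℝ, 0 < τ → τ < 1 / (Real.exp 1 * (-am)) →
      ∃ s₀ : ℝ, s₀ * Real.exp (s₀ * τ) = ap ∧
        ∀ i, ∀ s : ℂ, s * Complex.exp (s * τ) = ((a i : ℝ) : ℂ) → s.re ≤ s₀ := by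
  intro τ hτ hτlt
  obtain ⟨⟨j, rfl⟩, hmax⟩ := hap
  obtain ⟨⟨k, rfl⟩, hmin⟩ := ham
  have hak : 0 < -a k := neg_pos.2 (ha k)
  have hk : -a k * τ < Real.exp (-1) := by
    rw [lt_div_iff₀ (by positivity)] at hτlt
    rw [Real.exp_neg, ← one_div, lt_div_iff₀ (Real.exp_pos 1)]
    linarith
  have hsmall : ∀ i, -a i * τ < Real.exp (-1) := fun i =>
    (mul_le_mul_of_nonneg_right (neg_le_neg (hmin ⟨i, rfl⟩)) hτ.le).trans_lt hk
  obtain ⟨w, hw0, hw, hroot⟩ := exists_neg_root_mul_exp_eq hτ (ha j) (by linarith [hsmall j])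
  refine ⟨w, hroot, fun i s hs => ?_⟩
  by_contra! hlt
  have him : s.im = 0 := im_eq_zero_of_mul_exp_eq hτ (by rw [abs_of_neg (ha i)]; exact hsmall i) hs
    (hw.trans (mul_le_mul_of_nonneg_right hlt.le hτ.le))
  have hreal : s.re * Real.exp (s.re * τ) = a i := by
    rw [show s = (s.re : ℂ) from Complex.ext rfl (by simpa using him)] at hs
    exact_mod_cast hs
  have hstrict := mul_exp_mul_lt_mul_exp_mul hτ hw hw0 hlt
  rw [hroot, hreal] at hstrict
  exact hstrict.not_ge (hmax ⟨i, rfl⟩)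
end

section
/- Let n ≥ 1 and let a : Fin n → ℝ with a i < 0 for all i; set a₊ := max_i a i and a₋ := min_i a i. Then for every τ with 0 < τ < π/(2·(−a₋)), every i, and every s ∈ ℂ with s·exp(s·τ) = a i, there exists s' ∈ ℂ with (s'·exp(s'·τ) = a₊ or s'·exp(s'·τ) = a₋) and Re s ≤ Re s'. -/
open Real

theorem mul_sin_le_mul_sin {u v : ℝ} (hu : 0 ≤ u) (huv : u ≤ v) (hv : v ≤ π) :
    u * sin v ≤ v * sin u := by
  rcases (hu.trans huv).eq_or_lt with h | h
  · obtain rfl : v = 0 := h.symm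
    obtain rfl : u = 0 := le_antisymm huv hu
    simp
  have key := strictConcaveOn_sin_Icc.concaveOn.2 ⟨h.le, hv⟩ ⟨le_rfl, pi_pos.le⟩
    (div_nonneg hu h.le) (sub_nonneg.2 ((div_le_one h).2 huv)) (add_sub_cancel _ _)
  simp only [smul_eq_mul, sin_zero, mul_zero, add_zero, div_mul_cancel₀ _ h.ne'] at key
  rw [div_mul_eq_mul_div, div_le_iff₀ h] at key
  linarith

theorem sinc_mul_self (y : ℝ) : sinc y * y = sin y := by
  rcases eq_or_ne y 0 with rfl | h
  · simp
  · rw [sinc_of_ne_zero h, div_mul_cancel₀ _ h]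

theorem sinc_pos {y : ℝ} (h0 : 0 ≤ y) (hy : y < π) : 0 < sinc y := by
  rcases h0.eq_or_lt with rfl | h
  · simp
  · rw [sinc_of_ne_zero h.ne']
    exact div_pos (sin_pos_of_pos_of_lt_pi h hy) h

theorem cos_div_sinc_anti {y y' : ℝ} (h0 : 0 ≤ y) (hyy : y ≤ y') (hy' : y' ≤ π / 2) :
    cos y' / sinc y' ≤ cos y / sinc y := by
  have hpi := pi_pos
  rw [div_le_div_iff₀ (sinc_pos (h0.trans hyy) (by linarith)) (sinc_pos h0 (by linarith))]
  rcases h0.eq_or_lt with rfl | h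
  · rcases hyy.eq_or_lt with rfl | h'
    · simp
    rw [sinc_of_ne_zero h'.ne']
    simp only [sinc_zero, cos_zero, mul_one, one_mul]
    rw [le_div_iff₀ h', mul_comm]
    rcases hy'.eq_or_lt with rfl | hlt
    · simp
    · have ht := le_tan h'.le hlt
      rwa [tan_eq_sin_div_cos, le_div_iff₀ (cos_pos_of_mem_Ioo ⟨by linarith, hlt⟩)] at ht
  · have h' := h.trans_le hyy
    have hs := mul_sin_le_mul_sin (u := y' - y) (v := y' + y) (by linarith) (by linarith)
      (by linarith)
    rw [sin_add, sin_sub] at hs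
    rw [sinc_of_ne_zero h'.ne', sinc_of_ne_zero h.ne', mul_div_assoc', mul_div_assoc',
      div_le_div_iff₀ h h']
    linarith

/-- The intermediate value theorem on the real branch of `z * exp z`. -/
theorem exists_real_root_ge {x c : ℝ} (hx : x ≤ 0) (hc : 0 ≤ c) (h : x * exp x ≤ -c) :
    ∃ z : ℂ, z * Complex.exp z = ((-c : ℝ) : ℂ) ∧ x ≤ z.re := by
  obtain ⟨x', hx', he⟩ := intermediate_value_Icc (f := fun t => t * exp t) hx
    (by fun_prop) (show -c ∈ _ from ⟨h, by simpa using hc⟩)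
  refine ⟨x', ?_, hx'.1⟩
  rw [← he]
  push_cast
  rfl

/-- Along the curve `-cos t / sinc t + t * I`, `0 ≤ t ≤ π / 2`, the function `z * exp z` is real and
`-(z * exp z)` runs from `exp (-1)` to `π / 2`. -/
theorem exists_complex_root_ge {y c : ℝ} (h0 : 0 ≤ y) (hy : y ≤ π / 2) (hc : c ≤ π / 2)
    (h : exp (-(cos y / sinc y)) / sinc y ≤ c) :
    ∃ z : ℂ, z * Complex.exp z = ((-c : ℝ) : ℂ) ∧ -(cos y / sinc y) ≤ z.re := by
  have hpi := pi_pos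
  have hne : ∀ t ∈ Set.Icc y (π / 2), sinc t ≠ 0 := fun t ht =>
    (sinc_pos (h0.trans ht.1) (by linarith [ht.2])).ne'
  have hcont : ContinuousOn (fun t => exp (-(cos t / sinc t)) / sinc t) (Set.Icc y (π / 2)) := by
    have hs : ContinuousOn sinc (Set.Icc y (π / 2)) := continuous_sinc.continuousOn
    have hd : ContinuousOn (fun t => cos t / sinc t) (Set.Icc y (π / 2)) :=
      continuous_cos.continuousOn.div hs hne
    exact (hd.neg.rexp).div hs hne
  obtain ⟨t, ht, he⟩ := intermediate_value_Icc hy hcont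
    (show c ∈ _ from ⟨h, by simpa [sinc_of_ne_zero (div_pos pi_pos two_pos).ne'] using hc⟩)
  have hsinc := hne t ht
  refine ⟨⟨-(cos t / sinc t), t⟩, ?_, neg_le_neg (cos_div_sinc_anti h0 ht.1 ht.2)⟩
  have hsin := sinc_mul_self t
  have hcs := sin_sq_add_cos_sq t
  subst he
  apply Complex.ext
  · simp only [Complex.mul_re, Complex.exp_re, Complex.exp_im, Complex.ofReal_re]
    field_simp
    linear_combination (-1) * hcs - sin t * hsin
  · simp only [Complex.mul_im, Complex.exp_re, Complex.exp_im, Complex.ofReal_im]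
    field_simp
    linear_combination exp (-(cos t / sinc t)) * cos t * hsin

/-- A nonreal root of `z * exp z = -b` right of `-1` lies in the strip `0 < Im z ≤ π / 2`. -/
theorem root_of_im_pos {z : ℂ} {b : ℝ} (hb0 : 0 < b) (hb : b < π / 2)
    (hz : z * Complex.exp z = ((-b : ℝ) : ℂ)) (hy : 0 < z.im) (hx : -1 < z.re) :
    z.im ≤ π / 2 ∧ z.re = -(cos z.im / sinc z.im) ∧
      exp (-(cos z.im / sinc z.im)) / sinc z.im = b := by
  have hpi := pi_pos
  have hr := congrArg Complex.re hz
  have hi := congrArg Complex.im hz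
  simp only [Complex.mul_re, Complex.mul_im, Complex.exp_re, Complex.exp_im, Complex.ofReal_re,
    Complex.ofReal_im] at hr hi
  generalize z.re = x at *
  generalize z.im = y at *
  have hE := exp_pos x
  have hcs := sin_sq_add_cos_sq y
  have him : x * sin y + y * cos y = 0 := by
    have : exp x * (x * sin y + y * cos y) = 0 := by linarith
    exact (mul_eq_zero.1 this).resolve_left hE.ne'
  have hbs : b * sin y = exp x * y := by
    linear_combination sin y * hr - exp x * cos y * him + exp x * y * hcs
  have hsin : 0 < sin y := by
    have : 0 < b * sin y := hbs ▸ mul_pos hE hy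
    exact pos_of_mul_pos_right this hb0.le
  have hxe : x = -(cos y / sinc y) := by
    rw [sinc_of_ne_zero hy.ne']
    field_simp
    linarith
  refine ⟨?_, hxe, ?_⟩
  · by_contra! hlt
    have hey : exp x * y < π / 2 := by
      rw [← hbs]
      nlinarith [sin_le_one y]
    have hx0 : x < 0 := by
      rw [← exp_lt_one_iff]
      nlinarith
    have he3 : 1 < 3 * exp x := by
      have h1 : exp 1 * exp (-1) = 1 := by rw [← exp_add]; simp
      nlinarith [exp_one_lt_three, exp_lt_exp.2 hx, exp_pos (-1)]
    have hcos := cos_neg_of_pi_div_two_lt_of_lt hlt (by nlinarith)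
    nlinarith
  · rw [← hxe, sinc_of_ne_zero hy.ne']
    field_simp
    linarith

theorem exists_extreme_root {bp b bm : ℝ} (h0 : 0 < bp) (hp : bp ≤ b) (hm : b ≤ bm)
    (hpi : bm < π / 2) {z : ℂ} (hz : z * Complex.exp z = ((-b : ℝ) : ℂ)) :
    ∃ z' : ℂ, (z' * Complex.exp z' = ((-bp : ℝ) : ℂ) ∨ z' * Complex.exp z' = ((-bm : ℝ) : ℂ)) ∧
      z.re ≤ z'.re := by
  wlog hy : 0 ≤ z.im generalizing z
  · have := this (z := (starRingEnd ℂ) z)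
      (by rw [Complex.exp_conj, ← map_mul, hz, Complex.conj_ofReal]) (by simp; linarith)
    simpa using this
  rcases le_or_gt z.re (-1) with hx | hx
  · rcases le_or_gt bp (exp (-1)) with hc | hc
    · obtain ⟨w, hw, hre⟩ := exists_real_root_ge (x := -1) (by norm_num) h0.le (by linarith)
      exact ⟨w, .inl hw, hx.trans hre⟩
    · obtain ⟨w, hw, hre⟩ := exists_complex_root_ge (y := 0) (c := bm) le_rfl (by positivity)
        hpi.le (by simp; linarith)
      exact ⟨w, .inr hw, hx.trans (by simpa using hre)⟩
  rcases hy.eq_or_lt with hy | hy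
  · obtain ⟨x, y⟩ := z
    obtain rfl : y = 0 := hy.symm
    have hr := congrArg Complex.re hz
    simp [Complex.exp_re] at hr
    have hx0 : x ≤ 0 := by
      by_contra! hlt
      nlinarith [mul_pos hlt (exp_pos x)]
    obtain ⟨w, hw, hre⟩ := exists_real_root_ge hx0 h0.le (by linarith)
    exact ⟨w, .inl hw, hre⟩
  · obtain ⟨hle, hxe, hbe⟩ := root_of_im_pos (h0.trans_le hp) (hm.trans_lt hpi) hz hy hx
    obtain ⟨w, hw, hre⟩ := exists_complex_root_ge hy.le hle hpi.le (hbe.trans_le hm)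
    exact ⟨w, .inr hw, hxe.trans_le hre⟩

/-- Lemma 8 of the paper (parts (a)–(c) combined): for a real negative spectrum and any
admissible delay, the rightmost characteristic root over all eigenvalue equations is
attained on the equation of the largest (`a₊`) or the smallest (`a₋`) eigenvalue. -/
theorem rate_depends_on_extreme_eigenvalues (n : ℕ) (hn : 1 ≤ n) (a : Fin n → ℝ)
    (ha : ∀ i, a i < 0)
    (ap : ℝ) (hap : IsGreatest (Set.range a) ap)
    (am : ℝ) (ham : IsLeast (Set.range a) am) :
    ∀ τ : ℝ, 0 < τ → τ < Real.pi / (2 * (-am)) →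
      ∀ i, ∀ s : ℂ, s * Complex.exp (s * τ) = ((a i : ℝ) : ℂ) →
        ∃ s' : ℂ, (s' * Complex.exp (s' * τ) = ((ap : ℝ) : ℂ) ∨
          s' * Complex.exp (s' * τ) = ((am : ℝ) : ℂ)) ∧ s.re ≤ s'.re := by
  intro τ hτ hlt i s hs
  have hap0 : ap < 0 := by
    obtain ⟨j, rfl⟩ := hap.1
    exact ha j
  have hip : a i ≤ ap := hap.2 ⟨i, rfl⟩
  have him : am ≤ a i := ham.2 ⟨i, rfl⟩
  have hτ' : (τ : ℂ) ≠ 0 := by exact_mod_cast hτ.ne'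
  rw [lt_div_iff₀ (by linarith)] at hlt
  obtain ⟨w, hw, hre⟩ := exists_extreme_root (bp := -ap * τ) (b := -a i * τ) (bm := -am * τ)
    (mul_pos (by linarith) hτ) (by nlinarith) (by nlinarith) (by linarith) (z := s * τ)
    (by push_cast; linear_combination τ * hs)
  have scale : ∀ c : ℝ, w * Complex.exp w = ((-(-c * τ) : ℝ) : ℂ) →
      w / τ * Complex.exp (w / τ * τ) = (c : ℂ) := by
    intro c hc
    rw [div_mul_cancel₀ _ hτ', div_mul_eq_mul_div, hc, div_eq_iff hτ']
    push_cast
    ring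
  refine ⟨w / τ, hw.imp (scale ap) (scale am), ?_⟩
  rw [Complex.div_ofReal_re, le_div_iff₀ hτ]
  simpa using hre
end

section
/- There exists a unique θ ∈ (0, π) such that exp(−θ·(cos θ / sin θ)) = cos θ. (Its approximate value is 1.01125.) -/
/-- The function `θ ↦ θ * cot θ` is strictly decreasing on `(0, π)`. -/
theorem strictAntiOn_mul_cos_div_sin :
    StrictAntiOn (fun θ : ℝ => θ * (Real.cos θ / Real.sin θ)) (Set.Ioo 0 Real.pi) := by
  have hder : ∀ x ∈ Set.Ioo (0 : ℝ) Real.pi,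
      HasDerivAt (fun θ : ℝ => θ * (Real.cos θ / Real.sin θ))
        ((Real.sin x * Real.cos x - x) / Real.sin x ^ 2) x := by
    intro x hx
    have hs := (Real.sin_pos_of_mem_Ioo hx).ne'
    refine ((hasDerivAt_id' x).fun_mul
      ((Real.hasDerivAt_cos x).fun_div (Real.hasDerivAt_sin x) hs)).congr_deriv ?_
    field_simp
    linear_combination (-x) * Real.sin_sq_add_cos_sq x
  refine strictAntiOn_of_deriv_neg (convex_Ioo 0 Real.pi)
    (fun x hx => (hder x hx).continuousAt.continuousWithinAt) fun x hx => ?_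
  rw [interior_Ioo] at hx
  rw [(hder x hx).deriv]
  have hs := Real.sin_pos_of_mem_Ioo hx
  refine div_neg_of_neg_of_pos ?_ (by positivity)
  nlinarith [Real.sin_lt hx.1, Real.cos_le_one x]

/-- Lemma 2 of the paper: the transcendental equation `exp(−θ·cot θ) = cos θ` has a
unique solution in `(0, π)` (approximately `1.01125`). -/
theorem exists_unique_theta_tilde :
    ∃! θ : ℝ, θ ∈ Set.Ioo (0 : ℝ) Real.pi ∧
      Real.exp (-(θ * (Real.cos θ / Real.sin θ))) = Real.cos θ := by
  have hpi := Real.pi_gt_three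
  have hmono : StrictMonoOn
      (fun θ : ℝ => Real.exp (-(θ * (Real.cos θ / Real.sin θ))) - Real.cos θ)
      (Set.Ioo 0 Real.pi) := by
    intro x hx y hy hxy
    have hexp := Real.exp_lt_exp.mpr (neg_lt_neg (strictAntiOn_mul_cos_div_sin hx hy hxy))
    have hcos := Real.cos_lt_cos_of_nonneg_of_le_pi hx.1.le hy.2.le hxy
    exact sub_lt_sub hexp hcos
  have hcont : ContinuousOn
      (fun θ : ℝ => Real.exp (-(θ * (Real.cos θ / Real.sin θ))) - Real.cos θ)
      (Set.Icc (Real.pi / 4) (Real.pi / 2)) := by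
    have hs : ∀ x ∈ Set.Icc (Real.pi / 4) (Real.pi / 2), Real.sin x ≠ 0 := fun x hx =>
      (Real.sin_pos_of_pos_of_lt_pi (by linarith [hx.1]) (by linarith [hx.2])).ne'
    fun_prop (disch := assumption)
  have hleft : Real.exp (-(Real.pi / 4 * (Real.cos (Real.pi / 4) / Real.sin (Real.pi / 4))))
      - Real.cos (Real.pi / 4) ≤ 0 := by
    have hsqrt : (1.4 : ℝ) ≤ √2 := Real.le_sqrt_of_sq_le (by norm_num)
    rw [Real.cos_pi_div_four, Real.sin_pi_div_four, div_self (by positivity), mul_one,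
      Real.exp_neg]
    have hexp := Real.add_one_le_exp (Real.pi / 4)
    have hinv : (Real.exp (Real.pi / 4))⁻¹ ≤ (1.75 : ℝ)⁻¹ :=
      inv_anti₀ (by norm_num) (by linarith)
    norm_num at hinv hsqrt ⊢
    linarith
  have hright : 0 ≤ Real.exp (-(Real.pi / 2 * (Real.cos (Real.pi / 2) / Real.sin (Real.pi / 2))))
      - Real.cos (Real.pi / 2) := by
    simp
  obtain ⟨θ, hθ, hzero⟩ := intermediate_value_Icc (by linarith) hcont ⟨hleft, hright⟩
  have hmem : θ ∈ Set.Ioo 0 Real.pi := ⟨by linarith [hθ.1], by linarith [hθ.2]⟩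
  refine ⟨θ, ⟨hmem, sub_eq_zero.mp hzero⟩, ?_⟩
  rintro η ⟨hη, heq⟩
  exact hmono.injOn hη hmem ((sub_eq_zero.mpr heq).trans hzero.symm)
end

section
/- Let α ∈ ℝ with α < 0, and let θ̃ be the unique θ ∈ (0, π) with exp(−θ·cot θ) = cos θ. Then the set {τ ∈ ℝ | τ > 0 and there exists u ∈ (0, π) with ((α·τ : ℂ) + u·i)·exp((α·τ : ℂ) + u·i) = (α·τ : ℂ)} equals the singleton {θ̃·cot(θ̃)/(−α)}. -/
/-- For `u ∈ (0, π)`, the point `x + u * I` solves `z * exp z = x` exactly when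
`x = -u * cot u` and `exp x = cos u`. -/
theorem mul_exp_eq_ofReal_iff (x u : ℝ) (hu : u ∈ Set.Ioo 0 Real.pi) :
    ((x : ℂ) + (u : ℂ) * Complex.I) * Complex.exp ((x : ℂ) + (u : ℂ) * Complex.I) = (x : ℂ) ↔
      x = -(u * (Real.cos u / Real.sin u)) ∧ Real.exp x = Real.cos u := by
  have hsin : Real.sin u ≠ 0 := (Real.sin_pos_of_pos_of_lt_pi hu.1 hu.2).ne'
  have hu0 : u ≠ 0 := hu.1.ne'
  have hpyth := Real.sin_sq_add_cos_sq u
  have hcot : x = -(u * (Real.cos u / Real.sin u)) ↔ x * Real.sin u + u * Real.cos u = 0 := by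
    rw [← mul_div_assoc, ← neg_div, eq_div_iff hsin]
    constructor <;> intro h <;> linarith
  rw [hcot, Complex.ext_iff]
  simp only [Complex.mul_re, Complex.mul_im, Complex.add_re, Complex.add_im, Complex.exp_re,
    Complex.exp_im, Complex.ofReal_re, Complex.ofReal_im, Complex.I_re, Complex.I_im, mul_zero,
    mul_one, sub_zero, add_zero, zero_add]
  constructor
  · rintro ⟨hre, him⟩
    have hzero : x * Real.sin u + u * Real.cos u = 0 := by
      refine (mul_eq_zero.mp ?_).resolve_left (Real.exp_ne_zero x)
      linear_combination him
    refine ⟨hzero, mul_left_cancel₀ hu0 ?_⟩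
    linear_combination (Real.exp x * Real.cos u - 1) * hzero - Real.sin u * hre
      - u * Real.exp x * hpyth
  · rintro ⟨hzero, hexp⟩
    refine ⟨mul_right_cancel₀ hsin ?_, by linear_combination Real.exp x * hzero⟩
    linear_combination (Real.exp x * Real.cos u - 1) * hzero - u * hexp
      - u * Real.exp x * hpyth

/-- Lemma 2 of the paper: for real `α < 0`, the unique positive delay `τ` at which the
principal Lambert value `W₀(ατ)` has real part exactly `ατ` (the condition
`g(ατ) = 1`) is `τ̃ = θ̃·cot θ̃ / |α|`, where `θ̃` is the unique solution of
`exp(−θ cot θ) = cos θ` in `(0, π)`. -/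
theorem unique_delay_gain_one (α : ℝ) (hα : α < 0)
    (θt : ℝ) (hθ1 : θt ∈ Set.Ioo 0 Real.pi)
    (hθ2 : Real.exp (-(θt * (Real.cos θt / Real.sin θt))) = Real.cos θt)
    (hθu : ∀ θ ∈ Set.Ioo (0 : ℝ) Real.pi,
      Real.exp (-(θ * (Real.cos θ / Real.sin θ))) = Real.cos θ → θ = θt) :
    {τ : ℝ | 0 < τ ∧ ∃ u ∈ Set.Ioo (0 : ℝ) Real.pi,
      (((α * τ : ℝ) : ℂ) + (u : ℂ) * Complex.I) *
          Complex.exp (((α * τ : ℝ) : ℂ) + (u : ℂ) * Complex.I) = ((α * τ : ℝ) : ℂ)} =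
    {θt * (Real.cos θt / Real.sin θt) / (-α)} := by
  have hcancel (c : ℝ) : α * (c / -α) = -c := by
    rw [div_neg, mul_neg, mul_div_cancel₀ _ hα.ne]
  ext τ
  simp only [Set.mem_ofPred_eq, Set.mem_singleton_iff]
  constructor
  · rintro ⟨-, u, hu, h⟩
    obtain ⟨hx, hexp⟩ := (mul_exp_eq_ofReal_iff _ u hu).mp h
    obtain rfl : u = θt := hθu u hu (hx ▸ hexp)
    rw [eq_div_iff (neg_ne_zero.mpr hα.ne)]
    linarith
  · rintro rfl
    have hcos : 0 < Real.cos θt := hθ2 ▸ Real.exp_pos _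
    have hsin : 0 < Real.sin θt := Real.sin_pos_of_pos_of_lt_pi hθ1.1 hθ1.2
    refine ⟨div_pos (mul_pos hθ1.1 (div_pos hcos hsin)) (neg_pos.mpr hα), θt, hθ1, ?_⟩
    rw [hcancel]
    exact (mul_exp_eq_ofReal_iff _ θt hθ1).mpr ⟨rfl, hθ2⟩
end

section
/- Let α ∈ ℝ with α < 0 and set τ* := −1/(e·α) = 1/(e·|α|). Then: (i) the real number e·α satisfies (e·α)·exp((e·α)·τ*) = α, so s = e·α is a characteristic root for (α, τ*); and (ii) every s ∈ ℂ with s·exp(s·τ*) = α satisfies Re s ≤ e·α. -/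
/-- Every complex solution of `exp (-u) = 1 - u` lies in the closed left half-plane. -/
theorem re_nonpos_of_exp_neg_eq_one_sub {u : ℂ} (h : Complex.exp (-u) = 1 - u) :
    u.re ≤ 0 := by
  by_contra! ha
  have hre := congrArg Complex.re h
  have him := congrArg Complex.im h
  simp only [Complex.exp_re, Complex.exp_im, Complex.neg_re, Complex.neg_im, Complex.sub_re,
    Complex.sub_im, Complex.one_re, Complex.one_im, Real.cos_neg, Real.sin_neg] at hre him
  have hexp : Real.exp (-u.re) < 1 := Real.exp_lt_one_iff.mpr (by linarith)
  have hb : u.im = 0 := by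
    by_contra hne
    have hpos : 0 < |u.im| := abs_pos.mpr hne
    have habs : |u.im| = Real.exp (-u.re) * |Real.sin u.im| := by
      rw [← abs_of_pos (Real.exp_pos (-u.re)), ← abs_mul]
      congr 1
      linarith
    have hsin : |Real.sin u.im| ≤ |u.im| := Real.abs_sin_le_abs
    nlinarith [Real.exp_pos (-u.re)]
  rw [hb, Real.cos_zero] at hre
  linarith [Real.add_one_lt_exp (neg_ne_zero.mpr (ne_of_gt ha))]

/-- Every complex solution of `w * exp w = -exp (-1)` has real part at most `-1`. -/
theorem re_le_neg_one_of_mul_exp_eq {w : ℂ} (h : w * Complex.exp w = -Complex.exp (-1)) :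
    w.re ≤ -1 := by
  have hw : w = -Complex.exp (-1) * Complex.exp (-w) := by
    rw [← h, mul_assoc, ← Complex.exp_add, add_neg_cancel, Complex.exp_zero, mul_one]
  have hu : Complex.exp (-(w + 1)) = 1 - (w + 1) := by
    rw [neg_add, Complex.exp_add]
    linear_combination hw
  have hle := re_nonpos_of_exp_neg_eq_one_sub hu
  rw [Complex.add_re, Complex.one_re] at hle
  linarith

/-- Lemma 5(a),(c) of the paper: at the delay `τ* = −1/(e·α) = 1/(e·|α|)` the real
number `e·α` is a characteristic root for `(α, τ*)`, and every characteristic root has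
real part at most `e·α` (the delay rate gain attains its maximum value `e`). -/
theorem max_gain_at_tau_star (α : ℝ) (hα : α < 0) :
    ((Real.exp 1 * α) * Real.exp ((Real.exp 1 * α) * (-1 / (Real.exp 1 * α))) = α) ∧
    (∀ s : ℂ, s * Complex.exp (s * ((-1 / (Real.exp 1 * α) : ℝ) : ℂ)) = ((α : ℝ) : ℂ) →
      s.re ≤ Real.exp 1 * α) := by
  have heα : Real.exp 1 * α < 0 := mul_neg_of_pos_of_neg (Real.exp_pos 1) hα
  refine ⟨?_, fun s hs => ?_⟩
  · rw [mul_div_cancel₀ _ heα.ne, mul_right_comm, ← Real.exp_add, add_neg_cancel,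
      Real.exp_zero, one_mul]
  · set τ : ℝ := -1 / (Real.exp 1 * α) with hτ
    have hατ : α * τ = -Real.exp (-1) := by
      rw [hτ, Real.exp_neg]
      field_simp [hα.ne]
    have hw : s * (τ : ℂ) * Complex.exp (s * (τ : ℂ)) = -Complex.exp (-1) := by
      rw [mul_right_comm, hs]
      rw [← Complex.ofReal_mul, hατ]
      push_cast
      rfl
    have hle := re_le_neg_one_of_mul_exp_eq hw
    rw [Complex.re_mul_ofReal, hτ, mul_div_assoc', div_le_iff_of_neg heα] at hle
    linarith
end

section
/- Let α ∈ ℝ with α < 0, let θ̃ be the unique θ ∈ (0, π) with exp(−θ·cot θ) = cos θ, and set τ̃ := θ̃·cot(θ̃)/(−α) and τ̄ := π/(2·(−α)). Then: (i) for every τ ∈ (0, τ̃), every s ∈ ℂ with s·exp(s·τ) = α satisfies Re s < α; and (ii) for every τ ∈ (τ̃, τ̄) there exists s ∈ ℂ with s·exp(s·τ) = α and α < Re s < 0. -/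
open Real Set

theorem mul_cos_lt_sin_of_mem_Ioo {θ : ℝ} (h : θ ∈ Ioo 0 π) : θ * cos θ < sin θ := by
  have hs : 0 < sin θ := sin_pos_of_mem_Ioo h
  rcases lt_or_ge θ (π / 2) with h2 | h2
  · have hc : 0 < cos θ := cos_pos_of_mem_Ioo ⟨by linarith [h.1, pi_pos], h2⟩
    have ht := lt_tan h.1 h2
    rwa [tan_eq_sin_div_cos, lt_div_iff₀ hc] at ht
  · have hc : cos θ ≤ 0 := cos_nonpos_of_pi_div_two_le_of_le h2 (by linarith [h.2, pi_pos])
    linarith [mul_nonpos_of_nonneg_of_nonpos h.1.le hc]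

theorem sin_mul_cos_lt_self {θ : ℝ} (h : 0 < θ) : sin θ * cos θ < θ := by
  have := sin_lt (x := 2 * θ) (by linarith)
  rw [sin_two_mul] at this
  linarith

theorem strictMonoOn_div_sin_s17 : StrictMonoOn (fun θ : ℝ => θ / sin θ) (Ioo 0 π) := by
  have hd : ∀ θ ∈ Ioo 0 π,
      HasDerivAt (fun θ : ℝ => θ / sin θ) ((1 * sin θ - θ * cos θ) / sin θ ^ 2) θ :=
    fun θ h => (hasDerivAt_id θ).div (hasDerivAt_sin θ) (sin_pos_of_mem_Ioo h).ne'
  refine strictMonoOn_of_deriv_pos (convex_Ioo 0 π)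
    (fun θ h => (hd θ h).continuousAt.continuousWithinAt) fun θ h => ?_
  rw [interior_Ioo] at h
  rw [(hd θ h).deriv]
  have hs := sin_pos_of_mem_Ioo h
  have := mul_cos_lt_sin_of_mem_Ioo h
  exact div_pos (by linarith) (by positivity)

theorem strictAntiOn_mul_cot : StrictAntiOn (fun θ : ℝ => θ * (cos θ / sin θ)) (Ioo 0 π) := by
  have hd : ∀ θ ∈ Ioo 0 π, HasDerivAt (fun θ : ℝ => θ * (cos θ / sin θ))
      (1 * (cos θ / sin θ) + θ * ((-sin θ * sin θ - cos θ * cos θ) / sin θ ^ 2)) θ :=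
    fun θ h => (hasDerivAt_id θ).mul
      ((hasDerivAt_cos θ).div (hasDerivAt_sin θ) (sin_pos_of_mem_Ioo h).ne')
  refine strictAntiOn_of_deriv_neg (convex_Ioo 0 π)
    (fun θ h => (hd θ h).continuousAt.continuousWithinAt) fun θ h => ?_
  rw [interior_Ioo] at h
  rw [(hd θ h).deriv]
  have hs := sin_pos_of_mem_Ioo h
  have heq : 1 * (cos θ / sin θ) + θ * ((-sin θ * sin θ - cos θ * cos θ) / sin θ ^ 2)
      = (sin θ * cos θ - θ) / sin θ ^ 2 := by
    field_simp
    linear_combination -θ * sin_sq_add_cos_sq θ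
  rw [heq]
  exact div_neg_of_neg_of_pos (by linarith [sin_mul_cos_lt_self h.1]) (by positivity)

/-- The product `-α * τ` for which `-θ cot θ + iθ` solves `z * exp z = α * τ`. -/
noncomputable def delayOfAngle (θ : ℝ) : ℝ := θ / sin θ * exp (-(θ * (cos θ / sin θ)))

theorem strictMonoOn_delayOfAngle : StrictMonoOn delayOfAngle (Ioo 0 π) := by
  intro a ha b hb hab
  have h1 : a / sin a < b / sin b := strictMonoOn_div_sin_s17 ha hb hab
  have h2 : b * (cos b / sin b) < a * (cos a / sin a) := strictAntiOn_mul_cot ha hb hab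
  have h3 : 0 < b / sin b := div_pos hb.1 (sin_pos_of_mem_Ioo hb)
  unfold delayOfAngle
  exact mul_lt_mul h1 (exp_le_exp.2 (by linarith)) (exp_pos _) h3.le

theorem mul_exp_eq_ofReal_iff_s17 (z : ℂ) (c : ℝ) :
    z * Complex.exp z = (c : ℂ) ↔
      exp z.re * (z.re * cos z.im - z.im * sin z.im) = c ∧
        z.re * sin z.im + z.im * cos z.im = 0 := by
  have he : exp z.re ≠ 0 := (exp_pos _).ne'
  rw [Complex.ext_iff, Complex.mul_re, Complex.mul_im, Complex.exp_re, Complex.exp_im,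
    Complex.ofReal_re, Complex.ofReal_im]
  refine and_congr ⟨fun h => by linear_combination h, fun h => by linear_combination h⟩
    ⟨fun h => mul_left_cancel₀ he (by linear_combination h),
      fun h => by linear_combination exp z.re * h⟩

/-- The roots with imaginary part in `(0, π)`, parametrized by their angle. -/
theorem root_eq_of_im_mem_Ioo {p q c : ℝ} (hq : q ∈ Ioo 0 π)
    (him : p * sin q + q * cos q = 0) (hre : exp p * (p * cos q - q * sin q) = -c) :
    p = -(q * (cos q / sin q)) ∧ c = delayOfAngle q := by
  have hs := (sin_pos_of_mem_Ioo hq).ne'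
  have hp : p = -(q * (cos q / sin q)) := by
    field_simp
    linear_combination him
  refine ⟨hp, ?_⟩
  rw [delayOfAngle, ← hp]
  field_simp
  linear_combination sin q * hre - exp p * cos q * him + exp p * q * sin_sq_add_cos_sq q

theorem root_of_angle {θ : ℝ} (hθ : θ ∈ Ioo 0 π) :
    (⟨-(θ * (cos θ / sin θ)), θ⟩ : ℂ) * Complex.exp ⟨-(θ * (cos θ / sin θ)), θ⟩
      = ((-delayOfAngle θ : ℝ) : ℂ) := by
  have hs := (sin_pos_of_mem_Ioo hθ).ne'
  rw [mul_exp_eq_ofReal_iff_s17]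
  refine ⟨?_, by field_simp; ring⟩
  dsimp only
  rw [delayOfAngle]
  generalize exp (-(θ * (cos θ / sin θ))) = E
  field_simp
  linear_combination -E * θ * sin_sq_add_cos_sq θ

theorem delayOfAngle_threshold {θt : ℝ}
    (hθ2 : exp (-(θt * (cos θt / sin θt))) = cos θt) :
    delayOfAngle θt = θt * (cos θt / sin θt) := by
  rw [delayOfAngle, hθ2]
  ring

theorem exp_neg_mul_cot_lt_cos {θt : ℝ} (hθ1 : θt ∈ Ioo 0 π)
    (hθ2 : exp (-(θt * (cos θt / sin θt))) = cos θt) {θ : ℝ} (h0 : 0 < θ) (h : θ < θt) :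
    exp (-(θ * (cos θ / sin θ))) < cos θ := by
  have h1 : θt * (cos θt / sin θt) < θ * (cos θ / sin θ) :=
    strictAntiOn_mul_cot ⟨h0, h.trans hθ1.2⟩ hθ1 h
  calc exp (-(θ * (cos θ / sin θ))) < exp (-(θt * (cos θt / sin θt))) :=
        exp_lt_exp.2 (by linarith)
    _ = cos θt := hθ2
    _ < cos θ := cos_lt_cos_of_nonneg_of_le_pi h0.le hθ1.2.le h

theorem cos_lt_exp_neg_mul_cot {θt : ℝ} (hθ1 : θt ∈ Ioo 0 π)
    (hθ2 : exp (-(θt * (cos θt / sin θt))) = cos θt) {θ : ℝ} (h : θt < θ) (hπ : θ < π) :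
    cos θ < exp (-(θ * (cos θ / sin θ))) := by
  have h1 : θ * (cos θ / sin θ) < θt * (cos θt / sin θt) :=
    strictAntiOn_mul_cot hθ1 ⟨hθ1.1.trans h, hπ⟩ h
  calc cos θ < cos θt := cos_lt_cos_of_nonneg_of_le_pi hθ1.1.le hπ.le h
    _ = exp (-(θt * (cos θt / sin θt))) := hθ2.symm
    _ < exp (-(θ * (cos θ / sin θ))) := exp_lt_exp.2 (by linarith)

theorem re_lt_neg_of_im_nonneg {θt : ℝ} (hθ1 : θt ∈ Ioo 0 π)
    (hθ2 : exp (-(θt * (cos θt / sin θt))) = cos θt) {x p q : ℝ} (hx : 0 < x)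
    (hxt : x < θt * (cos θt / sin θt)) (hq : 0 ≤ q)
    (hre : exp p * (p * cos q - q * sin q) = -x) (him : p * sin q + q * cos q = 0) :
    p < -x := by
  have he := exp_pos p
  rcases hq.eq_or_lt with rfl | hq
  · simp only [cos_zero, sin_zero, mul_one, mul_zero, sub_zero] at hre
    have hp : p < 0 := by
      by_contra! hp
      linarith [mul_nonneg he.le hp]
    have : exp p < 1 := exp_lt_one_iff.2 hp
    nlinarith
  by_contra! hp
  have hx1 : x < 1 := by
    refine hxt.trans ?_
    rw [← mul_div_assoc, div_lt_one (sin_pos_of_mem_Ioo hθ1)]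
    exact mul_cos_lt_sin_of_mem_Ioo hθ1
  have hmod : (exp p * p) ^ 2 + (exp p * q) ^ 2 = x ^ 2 := by
    linear_combination (exp p * (p * cos q - q * sin q) - x) * hre +
      exp p ^ 2 * (p * sin q + q * cos q) * him -
      exp p ^ 2 * (p ^ 2 + q ^ 2) * sin_sq_add_cos_sq q
  have hqx : exp p * q ≤ x :=
    le_of_sq_le_sq (by nlinarith [sq_nonneg (exp p * p)]) hx.le
  have hq3 : q < 3 := by
    have h1 : exp (-1) ≤ exp p := exp_le_exp.2 (by linarith)
    have h2 : exp (-1) * exp 1 = 1 := by rw [← exp_add]; simp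
    have h3 : exp (-1) * q < 1 := by nlinarith
    have h4 : q < exp 1 := by
      by_contra! h
      nlinarith [exp_pos (-1)]
    linarith [exp_one_lt_d9]
  have hqm : q ∈ Ioo 0 π := ⟨hq, by linarith [pi_gt_three]⟩
  obtain ⟨hpq, hxq⟩ := root_eq_of_im_mem_Ioo hqm him hre
  have hlt : q < θt := by
    by_contra! h
    have := strictMonoOn_delayOfAngle.monotoneOn hθ1 hqm h
    rw [delayOfAngle_threshold hθ2] at this
    linarith
  have hs := sin_pos_of_mem_Ioo hqm
  have := mul_lt_mul_of_pos_left (exp_neg_mul_cot_lt_cos hθ1 hθ2 hq hlt) (div_pos hq hs)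
  rw [← delayOfAngle, ← hxq] at this
  have h5 : q / sin q * cos q = q * (cos q / sin q) := by ring
  linarith

theorem re_lt_neg_of_root {θt : ℝ} (hθ1 : θt ∈ Ioo 0 π)
    (hθ2 : exp (-(θt * (cos θt / sin θt))) = cos θt) {x : ℝ} (hx : 0 < x)
    (hxt : x < θt * (cos θt / sin θt)) {z : ℂ} (hz : z * Complex.exp z = ((-x : ℝ) : ℂ)) :
    z.re < -x := by
  obtain ⟨hre, him⟩ := (mul_exp_eq_ofReal_iff_s17 z (-x)).1 hz
  rcases le_total 0 z.im with h | h
  · exact re_lt_neg_of_im_nonneg hθ1 hθ2 hx hxt h hre him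
  · refine re_lt_neg_of_im_nonneg hθ1 hθ2 hx hxt (neg_nonneg.2 h) ?_ ?_
    · rw [cos_neg, sin_neg]
      linear_combination hre
    · rw [cos_neg, sin_neg]
      linear_combination -him

theorem exists_root_re_mem_Ioo {θt : ℝ} (hθ1 : θt ∈ Ioo 0 π)
    (hθ2 : exp (-(θt * (cos θt / sin θt))) = cos θt) {x : ℝ}
    (hxt : θt * (cos θt / sin θt) < x) (hxπ : x < π / 2) :
    ∃ z : ℂ, z * Complex.exp z = ((-x : ℝ) : ℂ) ∧ z.re ∈ Ioo (-x) 0 := by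
  have hθπ : θt < π / 2 := by
    by_contra! h
    have := cos_nonpos_of_pi_div_two_le_of_le h (by linarith [hθ1.2, pi_pos])
    linarith [exp_pos (-(θt * (cos θt / sin θt)))]
  have hcont : ContinuousOn delayOfAngle (Icc θt (π / 2)) := by
    have hs : ∀ θ ∈ Icc θt (π / 2), sin θ ≠ 0 := fun θ h =>
      (sin_pos_of_mem_Ioo ⟨hθ1.1.trans_le h.1, by linarith [h.2, pi_pos]⟩).ne'
    unfold delayOfAngle
    fun_prop (disch := assumption)
  have hx : x ∈ Ioo (delayOfAngle θt) (delayOfAngle (π / 2)) := by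
    rw [delayOfAngle_threshold hθ2]
    exact ⟨hxt, by simpa [delayOfAngle] using hxπ⟩
  obtain ⟨θ, ⟨h1, h2⟩, rfl⟩ := intermediate_value_Ioo hθπ.le hcont hx
  have h0 : 0 < θ := hθ1.1.trans h1
  have hm : θ ∈ Ioo 0 π := ⟨h0, by linarith [pi_pos]⟩
  have hs := sin_pos_of_mem_Ioo hm
  have hc : 0 < cos θ := cos_pos_of_mem_Ioo ⟨by linarith, h2⟩
  refine ⟨_, root_of_angle hm, ?_, neg_neg_of_pos (by positivity)⟩
  have := mul_lt_mul_of_pos_left (cos_lt_exp_neg_mul_cot hθ1 hθ2 h1 hm.2) (div_pos h0 hs)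
  rw [← delayOfAngle] at this
  have h5 : θ / sin θ * cos θ = θ * (cos θ / sin θ) := by ring
  dsimp only
  linarith

/-- Lemma 5(b) of the paper: for real `α < 0` and `τ̃ = θ̃·cot θ̃/|α|`, every
characteristic root for `(α, τ)` with `τ ∈ (0, τ̃)` has real part `< α` (delay rate
gain `> 1`), while for `τ ∈ (τ̃, τ̄)` some characteristic root has real part in
`(α, 0)` (gain strictly between `0` and `1`). -/
theorem gain_above_one_below_tilde_tau (α : ℝ) (hα : α < 0)
    (θt : ℝ) (hθ1 : θt ∈ Set.Ioo 0 Real.pi)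
    (hθ2 : Real.exp (-(θt * (Real.cos θt / Real.sin θt))) = Real.cos θt)
    (hθu : ∀ θ ∈ Set.Ioo (0 : ℝ) Real.pi,
      Real.exp (-(θ * (Real.cos θ / Real.sin θ))) = Real.cos θ → θ = θt) :
    (∀ τ : ℝ, 0 < τ → τ < θt * (Real.cos θt / Real.sin θt) / (-α) →
      ∀ s : ℂ, s * Complex.exp (s * τ) = ((α : ℝ) : ℂ) → s.re < α) ∧
    (∀ τ : ℝ, θt * (Real.cos θt / Real.sin θt) / (-α) < τ →
      τ < Real.pi / (2 * (-α)) →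
      ∃ s : ℂ, s * Complex.exp (s * τ) = ((α : ℝ) : ℂ) ∧ α < s.re ∧ s.re < 0) := by
  have ha : 0 < -α := neg_pos.2 hα
  refine ⟨fun τ hτ hlt s hs => ?_, fun τ hlt hτ => ?_⟩
  · rw [lt_div_iff₀ ha] at hlt
    have hz : s * τ * Complex.exp (s * τ) = ((-(τ * -α) : ℝ) : ℂ) := by
      push_cast
      linear_combination (τ : ℂ) * hs
    have h := re_lt_neg_of_root hθ1 hθ2 (mul_pos hτ ha) hlt hz
    rw [Complex.re_mul_ofReal] at h
    exact lt_of_mul_lt_mul_right (by linarith) hτ.le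
  · rw [div_lt_iff₀ ha] at hlt
    rw [lt_div_iff₀ (by linarith)] at hτ
    have hτ0 : 0 < τ := by
      have hc : 0 < Real.cos θt := hθ2 ▸ Real.exp_pos _
      have := mul_pos hθ1.1 (div_pos hc (Real.sin_pos_of_mem_Ioo hθ1))
      exact pos_of_mul_pos_left (this.trans hlt) ha.le
    obtain ⟨z, hz, hzl, hz0⟩ := exists_root_re_mem_Ioo hθ1 hθ2 hlt (by linarith)
    have hτc : (τ : ℂ) ≠ 0 := Complex.ofReal_ne_zero.2 hτ0.ne'
    refine ⟨z / τ, ?_, ?_, ?_⟩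
    · rw [div_mul_cancel₀ z hτc, div_mul_eq_mul_div, hz, div_eq_iff hτc]
      push_cast
      ring
    · rw [Complex.div_ofReal_re, lt_div_iff₀ hτ0]
      linarith
    · rw [Complex.div_ofReal_re]
      exact div_neg_of_neg_of_pos hz0 hτ0
end

section
/- Let α ∈ ℝ with α < 0. Then for every τ > 0 there exists s ∈ ℂ with s·exp(s·τ) = α and e·α ≤ Re s. -/
/-- For `0 ≤ b ≤ e⁻¹` the equation `x * exp x = -b` has a real solution in `[-1, 0]`. -/
lemma exists_real_mul_exp_eq_neg {b : ℝ} (hb : 0 ≤ b) (hb' : b ≤ Real.exp (-1)) :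
    ∃ x : ℝ, -1 ≤ x ∧ x * Real.exp x = -b := by
  have hcont : ContinuousOn (fun x : ℝ => x * Real.exp x) (Set.Icc (-1) 0) := by fun_prop
  obtain ⟨x, hx, hxb⟩ := intermediate_value_Icc (by norm_num) hcont
    (show -b ∈ Set.Icc _ _ from ⟨by simpa using hb', by simpa using hb⟩)
  exact ⟨x, hx.1, hxb⟩

lemma Real.sinc_pos_of_nonneg_of_lt_pi {v : ℝ} (hv : 0 ≤ v) (hv' : v < Real.pi) :
    0 < Real.sinc v := by
  rcases hv.eq_or_lt with rfl | hv
  · simp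
  · rw [Real.sinc_of_ne_zero hv.ne']
    exact div_pos (Real.sin_pos_of_pos_of_lt_pi hv hv') hv

lemma Real.cos_le_sinc_of_nonneg_of_lt_pi {v : ℝ} (hv : 0 ≤ v) (hv' : v < Real.pi) :
    Real.cos v ≤ Real.sinc v := by
  rcases hv.eq_or_lt with rfl | hv
  · simp
  rcases lt_or_ge v (Real.pi / 2) with h | h
  · rw [Real.sinc_of_ne_zero hv.ne', le_div_iff₀ hv]
    have hcos : 0 < Real.cos v := Real.cos_pos_of_mem_Ioo ⟨by linarith, h⟩
    have htan := Real.lt_tan hv h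
    rw [Real.tan_eq_sin_div_cos, lt_div_iff₀ hcos] at htan
    linarith
  · exact (Real.cos_nonpos_of_pi_div_two_le_of_le h (by linarith)).trans
      (Real.sinc_pos_of_nonneg_of_lt_pi hv.le hv').le

/-- The curve `v ↦ -cos v / sinc v + v * I` meets the level `-b` of `z * exp z`
for every `b ≥ e⁻¹`. -/
lemma exists_exp_neg_cos_div_sinc_eq {b : ℝ} (hb : Real.exp (-1) ≤ b) :
    ∃ v : ℝ, 0 ≤ v ∧ v < Real.pi ∧
      Real.exp (-(Real.cos v / Real.sinc v)) = b * Real.sinc v := by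
  have hb0 : 0 < b := (Real.exp_pos _).trans_le hb
  have hpi := Real.pi_gt_three
  obtain ⟨w, hw, hwpi, hwb⟩ : ∃ w, Real.pi / 2 ≤ w ∧ w < Real.pi ∧ b * Real.sinc w ≤ 1 := by
    set δ := min (Real.pi / 2) (1 / b)
    have hδ : 0 < δ := lt_min (by positivity) (by positivity)
    have hδpi : δ ≤ Real.pi / 2 := min_le_left _ _
    have hδb : b * δ ≤ 1 := by
      have := (le_div_iff₀ hb0).1 (min_le_right (Real.pi / 2) (1 / b))
      linarith
    refine ⟨Real.pi - δ, by linarith, by linarith, ?_⟩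
    have hpos : 0 < Real.pi - δ := by linarith
    rw [Real.sinc_of_ne_zero hpos.ne', Real.sin_pi_sub, ← mul_div_assoc, div_le_one hpos]
    have := mul_le_mul_of_nonneg_left (Real.sin_le hδ.le) hb0.le
    linarith
  have hw0 : 0 ≤ w := by linarith
  have hcont : ContinuousOn
      (fun v => Real.exp (-(Real.cos v / Real.sinc v)) - b * Real.sinc v) (Set.Icc 0 w) := by
    have hsinc : ContinuousOn Real.sinc (Set.Icc 0 w) := Real.continuous_sinc.continuousOn
    exact (Real.continuousOn_cos.div hsinc fun v hv =>
      (Real.sinc_pos_of_nonneg_of_lt_pi hv.1 (hv.2.trans_lt hwpi)).ne').neg.rexp.sub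
        (continuousOn_const.mul hsinc)
  have hright : 1 ≤ Real.exp (-(Real.cos w / Real.sinc w)) :=
    Real.one_le_exp (neg_nonneg.2 (div_nonpos_of_nonpos_of_nonneg
      (Real.cos_nonpos_of_pi_div_two_le_of_le hw (by linarith))
      (Real.sinc_pos_of_nonneg_of_lt_pi hw0 hwpi).le))
  obtain ⟨v, hv, hvb⟩ := intermediate_value_Icc hw0 hcont
    (show (0 : ℝ) ∈ Set.Icc _ _ from ⟨by simpa using hb, by linarith⟩)
  exact ⟨v, hv.1, hv.2.trans_lt hwpi, sub_eq_zero.1 hvb⟩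

/-- For `b ≥ e⁻¹` the equation `z * exp z = -b` has a solution with real part at least `-1`. -/
lemma exists_complex_mul_exp_eq_neg {b : ℝ} (hb : Real.exp (-1) ≤ b) :
    ∃ z : ℂ, -1 ≤ z.re ∧ z * Complex.exp z = -(b : ℂ) := by
  obtain ⟨v, hv, hvpi, hvb⟩ := exists_exp_neg_cos_div_sinc_eq hb
  have hs := Real.sinc_pos_of_nonneg_of_lt_pi hv hvpi
  have hle : Real.cos v / Real.sinc v ≤ 1 :=
    (div_le_one hs).2 (Real.cos_le_sinc_of_nonneg_of_lt_pi hv hvpi)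
  have hsin : v * Real.sinc v = Real.sin v := by
    rcases hv.eq_or_lt with rfl | hv
    · simp
    · rw [Real.sinc_of_ne_zero hv.ne', mul_div_cancel₀ _ hv.ne']
  set u : ℝ := -(Real.cos v / Real.sinc v) with hu
  have hcos : Real.cos v = -u * Real.sinc v := by
    rw [hu, neg_neg, div_mul_cancel₀ _ hs.ne']
  have hone : Real.sinc v * (u ^ 2 + v ^ 2) * Real.sinc v = 1 := by
    rw [← Real.sin_sq_add_cos_sq v, ← hsin, hcos]
    ring
  refine ⟨⟨u, v⟩, by simpa using by linarith, ?_⟩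
  apply Complex.ext
  · simp only [Complex.mul_re, Complex.exp_re, Complex.exp_im, Complex.neg_re,
      Complex.ofReal_re, hvb, hcos, ← hsin]
    linear_combination -b * hone
  · simp only [Complex.mul_im, Complex.exp_re, Complex.exp_im, Complex.neg_im,
      Complex.ofReal_im, hcos, ← hsin]
    ring

/-- Every equation `z * exp z = -b` with `b ≥ 0` has a solution with `Re z ≥ -e * b`. -/
lemma exists_mul_exp_eq_neg_and_le_re {b : ℝ} (hb : 0 ≤ b) :
    ∃ z : ℂ, z * Complex.exp z = -(b : ℂ) ∧ -(Real.exp 1 * b) ≤ z.re := by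
  rcases le_total b (Real.exp (-1)) with h | h
  · obtain ⟨x, hx, hxb⟩ := exists_real_mul_exp_eq_neg hb h
    refine ⟨x, by exact_mod_cast congrArg Complex.ofReal hxb, ?_⟩
    have hxe : x = -(Real.exp (-x) * b) := by
      rw [← mul_neg, ← hxb, mul_left_comm, ← Real.exp_add]
      simp
    have hexp : Real.exp (-x) * b ≤ Real.exp 1 * b :=
      mul_le_mul_of_nonneg_right (Real.exp_le_exp.2 (by linarith)) hb
    rw [Complex.ofReal_re]
    linarith
  · obtain ⟨z, hz, hzb⟩ := exists_complex_mul_exp_eq_neg h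
    refine ⟨z, hzb, ?_⟩
    have hexp : Real.exp 1 * Real.exp (-1) ≤ Real.exp 1 * b := by gcongr
    rw [← Real.exp_add, add_neg_cancel, Real.exp_zero] at hexp
    linarith

/-- Lemma 5(c) and Remark 1 of the paper: for every positive delay some characteristic
root for `(α, τ)` has real part at least `e·α`, so the convergence rate can never
exceed `e` times the delay-free rate `|α|`. -/
theorem ultimate_rate_bound (α : ℝ) (hα : α < 0) :
    ∀ τ : ℝ, 0 < τ →
      ∃ s : ℂ, s * Complex.exp (s * τ) = ((α : ℝ) : ℂ) ∧ Real.exp 1 * α ≤ s.re := by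
  intro τ hτ
  obtain ⟨z, hz, hre⟩ := exists_mul_exp_eq_neg_and_le_re
    (b := -α * τ) (mul_nonneg (neg_nonneg.2 hα.le) hτ.le)
  have hτ' : (τ : ℂ) ≠ 0 := by exact_mod_cast hτ.ne'
  refine ⟨z / τ, ?_, ?_⟩
  · rw [div_mul_cancel₀ _ hτ', div_mul_eq_mul_div, hz, div_eq_iff hτ']
    push_cast
    ring
  · rw [Complex.div_ofReal_re, le_div_iff₀ hτ]
    linarith
end

section
/- For every a ∈ (3π/4, 5π/4) there exists a unique θ ∈ (3π/4, 5π/4) such that θ − cos(2θ)·tan(θ)·exp(−cos(2θ)) = a. -/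
open Real in
/-- The derivative of `θ ↦ θ - cos (2θ) tan θ exp (-cos (2θ))`, in terms of `cos (2θ)`. -/
theorem hasDerivAt_sub_cos_two_mul_tan_mul_exp {θ : ℝ} (hθ : cos θ ≠ 0) :
    HasDerivAt (fun x => x - cos (2 * x) * tan x * exp (-cos (2 * x)))
      (1 + exp (-cos (2 * θ)) *
        (2 * (1 - cos (2 * θ)) ^ 2 - 2 * cos (2 * θ) / (1 + cos (2 * θ)))) θ := by
  have hcos : HasDerivAt (fun x => cos (2 * x)) (-sin (2 * θ) * (2 * 1)) θ :=
    ((hasDerivAt_id θ).const_mul 2).cos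
  have h := (hasDerivAt_id θ).sub ((hcos.mul (hasDerivAt_tan hθ)).mul hcos.neg.exp)
  refine h.congr_deriv ?_
  have hsin_tan : sin (2 * θ) * tan θ = 1 - cos (2 * θ) := by
    rw [tan_eq_sin_div_cos, sin_two_mul, cos_two_mul]
    field_simp
    linear_combination 2 * sin_sq_add_cos_sq θ
  have hsq : 2 * cos (2 * θ) / (1 + cos (2 * θ)) = cos (2 * θ) * (1 / cos θ ^ 2) := by
    rw [show 1 + cos (2 * θ) = 2 * cos θ ^ 2 by rw [cos_two_mul]; ring]
    field_simp
  rw [hsq]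
  simp only [Pi.mul_apply, Pi.neg_apply]
  linear_combination
    2 * exp (-cos (2 * θ)) * (1 - cos (2 * θ)) * hsin_tan

open Real in
theorem cos_two_mul_nonneg_of_mem_Icc {θ : ℝ} (hθ : θ ∈ Set.Icc (3 * π / 4) (5 * π / 4)) :
    0 ≤ cos (2 * θ) := by
  rw [← cos_sub_two_pi]
  exact cos_nonneg_of_neg_pi_div_two_le_of_le (by linarith [hθ.1]) (by linarith [hθ.2])

open Real in
theorem cos_ne_zero_of_cos_two_mul_nonneg {θ : ℝ} (hθ : 0 ≤ cos (2 * θ)) : cos θ ≠ 0 := by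
  intro h
  rw [cos_two_mul, h] at hθ
  norm_num at hθ

theorem one_add_exp_neg_mul_pos {c : ℝ} (h0 : 0 ≤ c) (h1 : c ≤ 1) :
    0 < 1 + Real.exp (-c) * (2 * (1 - c) ^ 2 - 2 * c / (1 + c)) := by
  have hdiv : 2 * c / (1 + c) ≤ 1 := by
    rw [div_le_one (by linarith)]
    linarith
  have hexp : Real.exp (-c) ≤ 1 := Real.exp_le_one_iff.mpr (by linarith)
  have hpos := Real.exp_pos (-c)
  rcases h1.eq_or_lt with rfl | hlt
  · norm_num
  · have hsq : 0 < (1 - c) ^ 2 := pow_pos (by linarith) 2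
    nlinarith [mul_pos hpos hsq, mul_le_mul_of_nonneg_left hdiv hpos.le]

open Real in
theorem continuousOn_sub_cos_two_mul_tan_mul_exp :
    ContinuousOn (fun x => x - cos (2 * x) * tan x * exp (-cos (2 * x)))
      (Set.Icc (3 * π / 4) (5 * π / 4)) := fun _ hx =>
  (hasDerivAt_sub_cos_two_mul_tan_mul_exp (cos_ne_zero_of_cos_two_mul_nonneg
    (cos_two_mul_nonneg_of_mem_Icc hx))).continuousAt.continuousWithinAt

open Real in
theorem strictMonoOn_sub_cos_two_mul_tan_mul_exp :
    StrictMonoOn (fun x => x - cos (2 * x) * tan x * exp (-cos (2 * x)))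
      (Set.Icc (3 * π / 4) (5 * π / 4)) := by
  refine strictMonoOn_of_deriv_pos (convex_Icc _ _)
    continuousOn_sub_cos_two_mul_tan_mul_exp fun x hx => ?_
  have hcos := cos_two_mul_nonneg_of_mem_Icc (interior_subset hx)
  rw [(hasDerivAt_sub_cos_two_mul_tan_mul_exp (cos_ne_zero_of_cos_two_mul_nonneg hcos)).deriv]
  exact one_add_exp_neg_mul_pos hcos (cos_le_one _)

/-- Lemma 6(c) of the paper: for every `a ∈ (3π/4, 5π/4)` the equation
`θ − cos(2θ)·tan(θ)·exp(−cos(2θ)) = a` has a unique solution `θ ∈ (3π/4, 5π/4)`. -/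
theorem exists_unique_theta_star :
    ∀ a ∈ Set.Ioo (3 * Real.pi / 4) (5 * Real.pi / 4),
      ∃! θ : ℝ, θ ∈ Set.Ioo (3 * Real.pi / 4) (5 * Real.pi / 4) ∧
        θ - Real.cos (2 * θ) * Real.tan θ * Real.exp (-Real.cos (2 * θ)) = a := by
  intro a ha
  have hleft : Real.cos (2 * (3 * Real.pi / 4)) = 0 :=
    Real.cos_eq_zero_iff.mpr ⟨1, by push_cast; ring⟩
  have hright : Real.cos (2 * (5 * Real.pi / 4)) = 0 :=
    Real.cos_eq_zero_iff.mpr ⟨2, by push_cast; ring⟩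
  obtain ⟨θ, hθ, hθa⟩ := intermediate_value_Ioo (by linarith [Real.pi_pos])
    continuousOn_sub_cos_two_mul_tan_mul_exp (by simpa [hleft, hright] using ha)
  refine ⟨θ, ⟨hθ, hθa⟩, fun y ⟨hy, hya⟩ => ?_⟩
  exact strictMonoOn_sub_cos_two_mul_tan_mul_exp.injOn (Set.Ioo_subset_Icc_self hy)
    (Set.Ioo_subset_Icc_self hθ) (hya.trans hθa.symm)
end
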